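/- arXiv:1809.00497 — 3 statements merged into one kernel-verified Lean document; each statement's English description precedes it below -/
import Mathlib

section
/- For the model filiform Lie superalgebra L_{n,m} over an algebraically closed field of characteristic zero, the k-th Betti number is dim H^k(L_{n,m}) = Σ_{k_0=0}^{k} f_{n,m}(k_0, k-k_0) + Σ_{k_0=0}^{k-1} f_{n,m}(k_0, k-k_0-1), where f_{n,m}(a,b) is the number of tuples (i_1,...,i_a, j_1,...,j_b) of integers with 1 ≤ i_1 < ... < i_a ≤ n, 1 ≤ j_1 < ... < j_b ≤ m+b-1, and Σ i_s + Σ j_t = ⌊(a(n+1)+b(m+1))/2⌋ + b(b-1)/2. -/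
open scoped Classical
open Finset

noncomputable section

namespace SuperCE

variable (F : Type*) [Field F] {B : Type*} [Fintype B] [DecidableEq B]

/-- Cochains of the super Chevalley–Eilenberg complex with trivial coefficients:
finitely supported families of coefficients indexed by exponent vectors of monomials in
the dual generators (exterior in duals of even basis vectors, polynomial in duals of odd
basis vectors). -/
abbrev Cochain (F : Type*) [Field F] (B : Type*) := (B → ℕ) →₀ F

variable (p ord : B → ℕ) (c : B → B → B → F)

/-- exponent vector of a single dual generator -/
def eps (b : B) : B → ℕ := fun x => if x = b then 1 else 0

/-- cohomological (`ℤ`-) degree of a monomial -/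
def deg (μ : B → ℕ) : ℕ := ∑ b, μ b

/-- admissible exponent vectors: duals of even basis vectors are exterior generators -/
def IsAdm (μ : B → ℕ) : Prop := ∀ b, p b = 0 → μ b ≤ 1

/-- Koszul sign for multiplying the ordered monomial with exponent vector `μ` by the one
with exponent vector `ν`: two dual generators supercommute, i.e. anticommute except that a
pair of generators dual to odd basis vectors commutes. -/
def sgnProd (μ ν : B → ℕ) : F :=
  (-1 : F) ^ (∑ b1, ∑ b2, if ord b2 < ord b1 then μ b1 * ν b2 * (1 + p b1 * p b2) else 0)

/-- the supercommutative product of cochains (wedge/polynomial multiplication) -/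
def Pmul (f g : Cochain F B) : Cochain F B :=
  f.sum fun μ a => g.sum fun ν b' =>
    if IsAdm p (fun x => μ x + ν x) then
      Finsupp.single (fun x => μ x + ν x) (a * b' * sgnProd F p ord μ ν)
    else 0

/-- coefficients of the differential on a dual generator `x_b*`, namely
`d(x_b*) = ∑_{k<l} (-1)^{|x_k||x_l|} c k l b x_k* x_l* - (1/2) ∑_{k odd} c k k b x_k*²`,
where `c k l b` is the structure constant of the Lie superalgebra. -/
def dcoef (b k l : B) : F :=
  if ord k < ord l then (-1 : F) ^ (p k * p l) * c k l b
  else if k = l ∧ p k = 1 then -((2 : F)⁻¹) * c k k b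
  else 0

/-- target exponent vector obtained from `μ` by differentiating the generator `b`
into the pair `(k, l)` -/
def tgt (μ : B → ℕ) (b k l : B) : B → ℕ :=
  fun x => μ x - eps b x + eps k x + eps l x

/-- the Chevalley–Eilenberg differential of a single monomial, obtained by extending `d`
on generators as a `ℤ`-degree `+1`, parity-even superderivation (Koszul signs included) -/
def dMono (μ : B → ℕ) : Cochain F B :=
  ∑ b, ∑ k, ∑ l,
    if μ b ≠ 0 ∧ IsAdm p (tgt μ b k l) then
      Finsupp.single (tgt μ b k l)
        (((-1 : F) ^ (∑ b', if ord b' < ord b then μ b' else 0)) *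
         (μ b : F) * ((-1 : F) ^ ((μ b - 1) * p b)) *
         ((-1 : F) ^ (p b * ∑ b'', if ord b < ord b'' then μ b'' * p b'' else 0)) *
         dcoef F p ord c b k l *
         sgnProd F p ord (fun x => μ x - eps b x) (fun x => eps k x + eps l x))
    else 0

/-- the Chevalley–Eilenberg differential with trivial coefficients -/
def d : Cochain F B →ₗ[F] Cochain F B :=
  Finsupp.lsum F fun μ => LinearMap.toSpanSingleton F (Cochain F B) (dMono F p ord c μ)

/-- cochains supported on admissible monomials of cohomological degree `k`,
i.e. the `k`-th term `Λᵏ g*` of the super Chevalley–Eilenberg complex -/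
def AdmDeg (k : ℕ) : Submodule F (Cochain F B) where
  carrier := {f | ∀ μ, f μ ≠ 0 → IsAdm p μ ∧ deg μ = k}
  add_mem' := by
    intro f g hf hg μ hμ
    by_cases h1 : f μ = 0
    · exact hg μ (by simpa [Finsupp.add_apply, h1] using hμ)
    · exact hf μ h1
  zero_mem' := by intro μ hμ; simp at hμ
  smul_mem' := by
    intro a f hf μ hμ
    exact hf μ (fun h0 => hμ (by simp [Finsupp.smul_apply, h0]))

/-- cochains supported on admissible monomials (of any degree), i.e. `Λ• g*` -/
def AdmAll : Submodule F (Cochain F B) where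
  carrier := {f | ∀ μ, f μ ≠ 0 → IsAdm p μ}
  add_mem' := by
    intro f g hf hg μ hμ
    by_cases h1 : f μ = 0
    · exact hg μ (by simpa [Finsupp.add_apply, h1] using hμ)
    · exact hf μ h1
  zero_mem' := by intro μ hμ; simp at hμ
  smul_mem' := by
    intro a f hf μ hμ
    exact hf μ (fun h0 => hμ (by simp [Finsupp.smul_apply, h0]))

/-- degree-`k` cocycles -/
def Zk (k : ℕ) : Submodule F (Cochain F B) :=
  AdmDeg F p k ⊓ LinearMap.ker (d F p ord c)

/-- degree-`k` coboundaries -/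
def Bk (k : ℕ) : Submodule F (Cochain F B) :=
  Submodule.map (d F p ord c) (AdmDeg F p (k - 1))

/-- the dimension (Betti number) of the `k`-th Lie superalgebra cohomology
`H^k = Z^k / B^k` with trivial coefficients -/
def Hdim (k : ℕ) : ℕ :=
  Module.finrank F ↥(Zk F p ord c k) -
    Module.finrank F ↥(Bk F p ord c k ⊓ Zk F p ord c k)

end SuperCE

end

noncomputable section
namespace Paper
open SuperCE

/-- parity of the standard basis of the model filiform Lie superalgebra `L_{n,m}`:
`X_0, …, X_n` are even, `Y_1, …, Y_m` are odd -/
def pL (n m : ℕ) : Fin (n + 1) ⊕ Fin m → ℕ := Sum.elim (fun _ => 0) (fun _ => 1)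

/-- ordering of the standard basis of `L_{n,m}` -/
def ordL (n m : ℕ) : Fin (n + 1) ⊕ Fin m → ℕ :=
  Sum.elim (fun i => (i : ℕ)) (fun j => (n + 1) + (j : ℕ))

/-- structure constants of the model filiform Lie superalgebra `L_{n,m}`:
`[X_0, X_i] = X_{i+1}` for `1 ≤ i ≤ n-1` and `[X_0, Y_j] = Y_{j+1}` for `1 ≤ j ≤ m-1`
(here `Sum.inl i` is `X_i` and `Sum.inr j` is `Y_{j+1}`), extended skew-supersymmetrically,
all other brackets of basis vectors being zero. -/
def cL (F : Type*) [Field F] (n m : ℕ) :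
    (Fin (n + 1) ⊕ Fin m) → (Fin (n + 1) ⊕ Fin m) → (Fin (n + 1) ⊕ Fin m) → F :=
  fun a b t =>
    match a, b, t with
    | Sum.inl i, Sum.inl j, Sum.inl k =>
        if (i : ℕ) = 0 ∧ 1 ≤ (j : ℕ) ∧ (j : ℕ) + 1 ≤ n ∧ (k : ℕ) = (j : ℕ) + 1 then 1
        else if (j : ℕ) = 0 ∧ 1 ≤ (i : ℕ) ∧ (i : ℕ) + 1 ≤ n ∧ (k : ℕ) = (i : ℕ) + 1 then -1
        else 0
    | Sum.inl i, Sum.inr j, Sum.inr k =>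
        if (i : ℕ) = 0 ∧ (j : ℕ) + 2 ≤ m ∧ (k : ℕ) = (j : ℕ) + 1 then 1 else 0
    | Sum.inr j, Sum.inl i, Sum.inr k =>
        if (i : ℕ) = 0 ∧ (j : ℕ) + 2 ≤ m ∧ (k : ℕ) = (j : ℕ) + 1 then -1 else 0
    | _, _, _ => 0

end Paper
end

noncomputable section
namespace Paper
open Finset

/-- the combinatorial count `f_{n,m}(a,b)`: the number of tuples
`1 ≤ i_1 < … < i_a ≤ n`, `1 ≤ j_1 < … < j_b ≤ m+b-1` with
`∑ i_s + ∑ j_t = ⌊(a(n+1)+b(m+1))/2⌋ + b(b-1)/2`. -/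
def fnm (n m a b : ℕ) : ℕ :=
  ((((Finset.Icc 1 n).powersetCard a) ×ˢ ((Finset.Icc 1 (m + b - 1)).powersetCard b)).filter
    (fun st => st.1.sum id + st.2.sum id =
      (a * (n + 1) + b * (m + 1)) / 2 + b * (b - 1) / 2)).card

end Paper
end

noncomputable section

namespace SlTwo

variable {F : Type*} [Field F]

/-- Rank–nullity for the restriction of a linear map to a submodule. -/
theorem finrank_map_add_finrank_inf_ker {V W : Type*} [AddCommGroup V] [Module F V]
    [AddCommGroup W] [Module F W] (f : V →ₗ[F] W) (P : Submodule F V) [FiniteDimensional F P] :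
    Module.finrank F (P.map f) + Module.finrank F ↥(P ⊓ LinearMap.ker f) =
      Module.finrank F P := by
  have h := LinearMap.finrank_range_add_finrank_ker (f.domRestrict P)
  rw [LinearMap.range_domRestrict, LinearMap.ker_domRestrict] at h
  rw [← h, ← Submodule.map_comap_subtype, Submodule.finrank_map_subtype_eq]

variable {ι : Type*}

theorem finrank_supported (T : Finset ι) :
    Module.finrank F (Finsupp.supported F F (T : Set ι)) = T.card := by
  rw [(Finsupp.supportedEquivFinsupp (M := F) (R := F) (T : Set ι)).finrank_eq]
  simp

instance finiteDimensional_supported (T : Finset ι) :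
    FiniteDimensional F (Finsupp.supported F F (T : Set ι)) :=
  Module.Finite.equiv (Finsupp.supportedEquivFinsupp (M := F) (R := F) (T : Set ι)).symm

/-- To map finitely supported functions on `s` into a submodule, it is enough to do so for the
point masses. -/
theorem map_mem_of_single {W : Type*} [AddCommGroup W] [Module F W] {s : Set ι}
    {f : (ι →₀ F) →ₗ[F] W} {P : Submodule F W} (h : ∀ i ∈ s, f (Finsupp.single i 1) ∈ P)
    {v : ι →₀ F} (hv : v ∈ Finsupp.supported F F s) : f v ∈ P := by
  have : Finsupp.supported F F s ≤ P.comap f := by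
    rw [Finsupp.supported_eq_span_single, Submodule.span_le]
    rintro _ ⟨i, hi, rfl⟩
    exact h i hi
  exact this hv

theorem map_eq_of_single {W : Type*} [AddCommGroup W] [Module F W] {s : Set ι}
    {f g : (ι →₀ F) →ₗ[F] W} (h : ∀ i ∈ s, f (Finsupp.single i 1) = g (Finsupp.single i 1))
    {v : ι →₀ F} (hv : v ∈ Finsupp.supported F F s) : f v = g v := by
  have := map_mem_of_single (f := f - g) (P := ⊥) (fun i hi => by simp [h i hi]) hv
  simpa [sub_eq_zero] using this

variable (T : Finset ι) (h : ι → ℤ)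

/-- The `j`-th weight space: functions supported on the points of `T` of weight `j`. -/
abbrev wtSpace (F : Type*) [Field F] (j : ℤ) : Submodule F (ι →₀ F) :=
  Finsupp.supported F F {i | i ∈ T ∧ h i = j}

/-- Lowering and raising operators `D`, `U` on the functions on `T`, such that `[D, U]` acts on
the point mass at `i` as multiplication by `-h i`. -/
structure IsLoweringRaising (D U : Module.End F (ι →₀ F)) : Prop where
  lower : ∀ i ∈ T, D (Finsupp.single i 1) ∈ wtSpace T h F (h i - 2)
  raise : ∀ i ∈ T, U (Finsupp.single i 1) ∈ wtSpace T h F (h i + 2)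
  comm : ∀ i ∈ T, D (U (Finsupp.single i 1)) =
    U (D (Finsupp.single i 1)) - (h i : F) • Finsupp.single i 1

namespace IsLoweringRaising

variable {T h} {D U : Module.End F (ι →₀ F)}

theorem lower_mem (H : IsLoweringRaising T h D U) {j : ℤ} {v : ι →₀ F}
    (hv : v ∈ wtSpace T h F j) : D v ∈ wtSpace T h F (j - 2) :=
  map_mem_of_single (fun i hi => hi.2 ▸ H.lower i hi.1) hv

theorem raise_mem (H : IsLoweringRaising T h D U) {j : ℤ} {v : ι →₀ F}
    (hv : v ∈ wtSpace T h F j) : U v ∈ wtSpace T h F (j + 2) :=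
  map_mem_of_single (fun i hi => hi.2 ▸ H.raise i hi.1) hv

theorem comm_apply (H : IsLoweringRaising T h D U) {j : ℤ} {v : ι →₀ F}
    (hv : v ∈ wtSpace T h F j) : D (U v) = U (D v) - (j : F) • v :=
  map_eq_of_single (f := D ∘ₗ U) (g := U ∘ₗ D - (j : F) • LinearMap.id)
    (fun i hi => by simpa [← hi.2] using H.comm i hi.1) hv

theorem lower_pow_mem (H : IsLoweringRaising T h D U) {j : ℤ} {v : ι →₀ F}
    (hv : v ∈ wtSpace T h F j) (r : ℕ) : (D ^ r) v ∈ wtSpace T h F (j - 2 * r) := by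
  induction r with
  | zero => simpa using hv
  | succ r ih =>
    rw [pow_succ', Module.End.mul_apply]
    convert H.lower_mem ih using 2
    push_cast; ring

theorem raise_pow_mem (H : IsLoweringRaising T h D U) {j : ℤ} {v : ι →₀ F}
    (hv : v ∈ wtSpace T h F j) (r : ℕ) : (U ^ r) v ∈ wtSpace T h F (j + 2 * r) := by
  induction r with
  | zero => simpa using hv
  | succ r ih =>
    rw [pow_succ', Module.End.mul_apply]
    convert H.raise_mem ih using 2
    push_cast; ring

theorem exists_bound (T : Finset ι) (h : ι → ℤ) : ∃ N : ℕ, ∀ i ∈ T, |h i| < N := by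
  refine ⟨(∑ i ∈ T, (h i).natAbs) + 1, fun i hi => ?_⟩
  have : (h i).natAbs ≤ ∑ i ∈ T, (h i).natAbs :=
    Finset.single_le_sum (f := fun i => (h i).natAbs) (fun _ _ => Nat.zero_le _) hi
  rw [Int.abs_eq_natAbs]
  exact_mod_cast Nat.lt_succ_of_le this

theorem eq_zero_of_mem_wtSpace {N : ℕ} (hN : ∀ i ∈ T, |h i| < N) {j : ℤ} (hj : (N : ℤ) ≤ |j|)
    {v : ι →₀ F} (hv : v ∈ wtSpace T h F j) : v = 0 := by
  ext i
  by_contra hi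
  have := hv (Finsupp.mem_support_iff.2 hi)
  have h1 := hN i this.1
  rw [this.2] at h1
  omega

theorem exists_lower_pow_eq_zero (H : IsLoweringRaising T h D U) {j : ℤ} {v : ι →₀ F}
    (hv : v ∈ wtSpace T h F j) : ∃ r : ℕ, (D ^ r) v = 0 := by
  obtain ⟨N, hN⟩ := exists_bound T h
  refine ⟨N + j.natAbs, eq_zero_of_mem_wtSpace hN ?_ (H.lower_pow_mem hv _)⟩
  push_cast
  grind

theorem exists_raise_pow_eq_zero (H : IsLoweringRaising T h D U) {j : ℤ} {v : ι →₀ F}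
    (hv : v ∈ wtSpace T h F j) : ∃ r : ℕ, (U ^ r) v = 0 := by
  obtain ⟨N, hN⟩ := exists_bound T h
  refine ⟨N + j.natAbs, eq_zero_of_mem_wtSpace hN ?_ (H.raise_pow_mem hv _)⟩
  push_cast
  grind

theorem lower_pow_raise (H : IsLoweringRaising T h D U) {j : ℤ} {v : ι →₀ F}
    (hv : v ∈ wtSpace T h F j) (r : ℕ) :
    (D ^ (r + 1)) (U v) = U ((D ^ (r + 1)) v) + ((r + 1) * (r - j) : F) • (D ^ r) v := by
  induction r with
  | zero => simp [H.comm_apply hv, sub_eq_add_neg]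
  | succ r ih =>
    have e (t : ℕ) (x : ι →₀ F) : (D ^ (t + 1)) x = D ((D ^ t) x) := by
      rw [pow_succ', Module.End.mul_apply]
    rw [e (r + 1), ih, map_add, map_smul, H.comm_apply (H.lower_pow_mem hv (r + 1)), ← e r,
      ← e (r + 1)]
    push_cast
    module

theorem lower_raise_pow (H : IsLoweringRaising T h D U) {j : ℤ} {v : ι →₀ F}
    (hv : v ∈ wtSpace T h F j) (hD : D v = 0) (r : ℕ) :
    D ((U ^ (r + 1)) v) = (-((r + 1) * (r + j)) : F) • (U ^ r) v := by
  induction r with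
  | zero => simp [H.comm_apply hv, hD]
  | succ r ih =>
    rw [pow_succ', Module.End.mul_apply, H.comm_apply (H.raise_pow_mem hv (r + 1)), ih, map_smul,
      ← Module.End.mul_apply U, ← pow_succ', ← sub_smul]
    congr 1
    push_cast; ring

theorem lower_filter (H : IsLoweringRaising T h D U) (j : ℤ) {v : ι →₀ F}
    (hv : v ∈ Finsupp.supported F F (T : Set ι)) :
    D (v.filter fun i => h i = j) = (D v).filter fun i => h i = j - 2 := by
  let proj (j : ℤ) : (ι →₀ F) →ₗ[F] (ι →₀ F) :=
    Submodule.subtype _ ∘ₗ Finsupp.restrictDom F F {i | h i = j}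
  refine map_eq_of_single (f := D ∘ₗ proj j) (g := proj (j - 2) ∘ₗ D) (fun i hi => ?_) hv
  change D ((Finsupp.single i 1).filter fun i => h i = j) =
    (D (Finsupp.single i 1)).filter fun i => h i = j - 2
  have hl := H.lower i hi
  by_cases hij : h i = j
  · rw [Finsupp.filter_single_of_pos (fun i => h i = j) hij, eq_comm, Finsupp.filter_eq_self_iff]
    intro x hx
    rw [(hl (Finsupp.mem_support_iff.2 hx)).2, hij]
  · rw [Finsupp.filter_single_of_neg (fun i => h i = j) hij, map_zero, eq_comm,
      Finsupp.filter_eq_zero_iff]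
    intro x hx
    by_contra hne
    have := (hl (Finsupp.mem_support_iff.2 hne)).2
    omega

variable [CharZero F]

/-- `D` is surjective onto the weight spaces of negative weight. -/
theorem exists_lower_eq (H : IsLoweringRaising T h D U) {j : ℤ} (hj : j < 0) {w : ι →₀ F}
    (hw : w ∈ wtSpace T h F j) : ∃ v ∈ wtSpace T h F (j + 2), D v = w := by
  obtain ⟨r, hr⟩ := H.exists_lower_pow_eq_zero hw
  induction r generalizing w with
  | zero => exact ⟨0, zero_mem _, by simpa using hr.symm⟩
  | succ r ih =>
    have hc : ((r + 1) * (r - j) : F) ≠ 0 := by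
      have : ((r + 1) * (r - j) : ℤ) ≠ 0 := by
        apply mul_ne_zero <;> omega
      exact_mod_cast this
    have hU : D (U w) ∈ wtSpace T h F j := by
      simpa using H.lower_mem (H.raise_mem hw)
    obtain ⟨v, hv, hvw⟩ := ih (w := D (U w) - ((r + 1) * (r - j) : F) • w)
      (sub_mem hU (Submodule.smul_mem _ _ hw)) (by
        rw [map_sub, map_smul, ← Module.End.mul_apply, ← pow_succ, H.lower_pow_raise hw, hr]
        simp)
    refine ⟨((r + 1) * (r - j) : F)⁻¹ • (U w - v), Submodule.smul_mem _ _
      (sub_mem (H.raise_mem hw) hv), ?_⟩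
    rw [map_smul, map_sub, hvw, sub_sub_cancel, inv_smul_smul₀ hc]

/-- `D` is injective on the weight spaces of positive weight. -/
theorem eq_zero_of_lower_eq_zero (H : IsLoweringRaising T h D U) {j : ℤ} (hj : 0 < j)
    {v : ι →₀ F} (hv : v ∈ wtSpace T h F j) (hD : D v = 0) : v = 0 := by
  obtain ⟨r, hr⟩ := H.exists_raise_pow_eq_zero hv
  induction r with
  | zero => simpa using hr
  | succ r ih =>
    have hc : (-((r + 1) * (r + j)) : F) ≠ 0 := by
      have : (-((r + 1) * (r + j)) : ℤ) ≠ 0 := by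
        apply neg_ne_zero.2; apply mul_ne_zero <;> omega
      exact_mod_cast this
    have := H.lower_raise_pow hv hD r
    rw [hr, map_zero] at this
    exact ih ((smul_eq_zero.1 this.symm).resolve_left hc)

/-- The kernel of the lowering operator has as many dimensions as there are points of
weight `0` or `-1`. -/
theorem finrank_ker (H : IsLoweringRaising T h D U) :
    Module.finrank F ↥(Finsupp.supported F F (T : Set ι) ⊓ LinearMap.ker D) =
      (T.filter fun i => h i = 0 ∨ h i = -1).card := by
  set P := T.filter fun i => h i ≤ 0
  set Q := T.filter fun i => h i ≤ -2
  have hK : Finsupp.supported F F (T : Set ι) ⊓ LinearMap.ker D =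
      Finsupp.supported F F (P : Set ι) ⊓ LinearMap.ker D := by
    refine le_antisymm ?_ (inf_le_inf_right _
      (Finsupp.supported_mono (Finset.coe_subset.2 (Finset.filter_subset _ _))))
    rintro v ⟨hv, hD⟩
    refine ⟨fun i hi => ?_, hD⟩
    have hiT := hv hi
    rw [Finset.mem_coe, Finset.mem_filter]
    refine ⟨hiT, not_lt.1 fun hpos => Finsupp.mem_support_iff.1 hi ?_⟩
    have hz := H.eq_zero_of_lower_eq_zero hpos (v := v.filter fun x => h x = h i) ?_ ?_
    · simpa using DFunLike.congr_fun hz i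
    · intro x hx
      simp only [Finset.mem_coe, Finsupp.support_filter, Finset.mem_filter] at hx
      exact ⟨hv hx.1, hx.2⟩
    · rw [H.lower_filter _ hv, LinearMap.mem_ker.1 hD]
      exact Finsupp.filter_zero _
  have hmap : (Finsupp.supported F F (P : Set ι)).map D = Finsupp.supported F F (Q : Set ι) := by
    apply le_antisymm
    · rintro _ ⟨v, hv, rfl⟩
      refine map_mem_of_single (fun i hi => ?_) hv
      simp only [P, Finset.mem_coe, Finset.mem_filter] at hi
      refine Finsupp.supported_mono ?_ (H.lower i hi.1)
      rintro x ⟨hx, hx'⟩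
      simp only [Q, Finset.mem_coe, Finset.mem_filter]
      exact ⟨hx, by omega⟩
    · intro w hw
      refine map_mem_of_single (f := LinearMap.id) (fun i hi => ?_) hw
      simp only [Q, Finset.mem_coe, Finset.mem_filter] at hi
      obtain ⟨v, hv, hvw⟩ := H.exists_lower_eq (j := h i) (by omega)
        (w := Finsupp.single i 1) (Finsupp.single_mem_supported F 1 ⟨hi.1, rfl⟩)
      refine ⟨v, Finsupp.supported_mono ?_ hv, hvw⟩
      rintro x ⟨hx, hx'⟩
      simp only [P, Finset.mem_coe, Finset.mem_filter]
      exact ⟨hx, by omega⟩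
  have := finrank_map_add_finrank_inf_ker D (Finsupp.supported F F (P : Set ι))
  rw [hmap, finrank_supported, finrank_supported, ← hK] at this
  have hcard : (T.filter fun i => h i = 0 ∨ h i = -1).card + Q.card = P.card := by
    rw [← Finset.card_union_of_disjoint, ← Finset.filter_or]
    · congr 1
      ext i
      simp only [P, Finset.mem_filter]
      constructor <;> rintro ⟨h1, h2⟩ <;> exact ⟨h1, by omega⟩
    · exact Finset.disjoint_filter.2 fun i _ h1 h2 => by omega
  omega

end IsLoweringRaising
end SlTwo
end

noncomputable section
namespace Paper
open SuperCE Finset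

/-- Splitting the functions `Fin (m + 1) → ℕ` with sum `b + 1` according to whether the last
value vanishes. -/
theorem sum_piAntidiag_fin_succ (m b : ℕ) (g : (Fin (m + 1) → ℕ) → ℕ) :
    ∑ μ ∈ piAntidiag univ (b + 1), g μ =
      (∑ ν ∈ piAntidiag (univ : Finset (Fin m)) (b + 1), g (Fin.snoc (α := fun _ => ℕ) ν 0)) +
        ∑ ν ∈ piAntidiag (univ : Finset (Fin (m + 1))) b, g (ν + Pi.single (Fin.last m) 1) := by
  rw [← sum_filter_add_sum_filter_not _ (fun μ => μ (Fin.last m) = 0)]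
  congr 1
  · refine sum_nbij' (fun μ => Fin.init (α := fun _ => ℕ) μ)
      (fun ν => Fin.snoc (α := fun _ => ℕ) ν 0) ?_ ?_ ?_ ?_ ?_
    · intro μ hμ
      simp only [mem_filter, mem_piAntidiag, mem_univ, implies_true, and_true] at hμ ⊢
      rw [← hμ.1, Fin.sum_univ_castSucc, hμ.2]
      rfl
    · intro ν hν
      simp only [mem_filter, mem_piAntidiag, mem_univ, implies_true, and_true] at hν ⊢
      simp [Fin.sum_univ_castSucc, hν]
    · intro μ hμ
      rw [← (mem_filter.1 hμ).2]
      exact Fin.snoc_init_self μ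
    · intro ν _
      simp
    · intro μ hμ
      rw [← (mem_filter.1 hμ).2]
      exact congrArg g (Fin.snoc_init_self μ).symm
  · refine sum_nbij' (fun μ => μ - Pi.single (Fin.last m) 1)
      (fun ν => ν + Pi.single (Fin.last m) 1) ?_ ?_ ?_ ?_ ?_
    · intro μ hμ
      simp only [mem_filter, mem_piAntidiag, mem_univ, implies_true, and_true] at hμ ⊢
      have := hμ.1
      rw [Fin.sum_univ_castSucc] at this ⊢
      simp [Fin.castSucc_ne_last]
      omega
    · intro ν hν
      simp only [mem_filter, mem_piAntidiag, mem_univ, implies_true, and_true] at hν ⊢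
      simp [sum_add_distrib, hν]
    · intro μ hμ
      have := (mem_filter.1 hμ).2
      ext x
      by_cases hx : x = Fin.last m
      · subst hx; simp; omega
      · simp [hx]
    · intro ν _
      simp
    · intro μ hμ
      have := (mem_filter.1 hμ).2
      congr 1
      ext x
      by_cases hx : x = Fin.last m
      · subst hx; simp; omega
      · simp [hx]

/-- Weighted form of the bijection between multisets of size `b` in `{1, …, m}` and `b`-element
subsets of `{1, …, m + b - 1}`, which raises the sum of the elements by `b.choose 2`. -/
theorem sum_piAntidiag_eq_sum_powersetCard (m b : ℕ) (φ : ℕ → ℕ) :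
    ∑ μ ∈ piAntidiag (univ : Finset (Fin m)) b, φ (∑ j, μ j * ((j : ℕ) + 1) + b.choose 2) =
      ∑ t ∈ (Icc 1 (m + b - 1)).powersetCard b, φ (t.sum id) := by
  induction m generalizing b φ with
  | zero =>
    cases b with
    | zero => simp
    | succ b => simp [powersetCard_eq_empty.2]
  | succ m ihm =>
    induction b generalizing φ with
    | zero => simp
    | succ b ihb =>
      have hI : Icc 1 (m + 1 + (b + 1) - 1) = insert (m + b + 1) (Icc 1 (m + b)) := by
        ext x; simp only [mem_Icc, mem_insert]; omega
      have hx : m + b + 1 ∉ Icc 1 (m + b) := by simp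
      rw [sum_piAntidiag_fin_succ, hI, powersetCard_succ_insert hx, sum_union, sum_image]
      · congr 1
        · rw [show m + b = m + (b + 1) - 1 by omega, ← ihm]
          simp [Fin.sum_univ_castSucc]
        · rw [show m + b = m + 1 + b - 1 by omega]
          have := ihb fun x => φ (x + (m + b + 1))
          rw [show ∑ t ∈ powersetCard b (Icc 1 (m + 1 + b - 1)),
              φ ((insert (m + 1 + b - 1 + 1) t).sum id) =
              ∑ t ∈ powersetCard b (Icc 1 (m + 1 + b - 1)), φ (t.sum id + (m + b + 1)) from ?_,
            ← this]
          · refine sum_congr rfl fun μ _ => congrArg φ ?_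
            simp [add_mul, sum_add_distrib, Nat.choose_succ_succ' b 1, Pi.single_apply]
            omega
          · refine sum_congr rfl fun t ht => congrArg φ ?_
            rw [sum_insert, id]
            · have : ∑ x ∈ t, id x = t.sum id := rfl
              omega
            · intro hmem
              have := mem_Icc.1 ((mem_powersetCard.1 ht).1 hmem)
              omega
      · intro s hs t ht hst
        have hs' : m + b + 1 ∉ s := fun h' => hx ((mem_powersetCard.1 hs).1 h')
        have ht' : m + b + 1 ∉ t := fun h' => hx ((mem_powersetCard.1 ht).1 h')
        rw [← erase_insert hs', ← erase_insert ht']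
        exact congrArg (fun u => u.erase (m + b + 1)) hst
      · rw [disjoint_left]
        intro s hs hs'
        obtain ⟨t, _, rfl⟩ := mem_image.1 hs'
        exact hx ((mem_powersetCard.1 hs).1 (mem_insert_self _ _))

/-- The sum defining `fnm` counts pairs of a subset of `{1, …, n}` and a multiset in
`{1, …, m}` with prescribed total. -/
theorem fnm_eq_card (n m a b : ℕ) :
    fnm n m a b = (((Icc 1 n).powersetCard a ×ˢ piAntidiag (univ : Finset (Fin m)) b).filter
      fun st => st.1.sum id + ∑ j : Fin m, st.2 j * ((j : ℕ) + 1) =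
        (a * (n + 1) + b * (m + 1)) / 2).card := by
  rw [fnm, card_filter, card_filter, sum_product, sum_product]
  refine sum_congr rfl fun s _ => ?_
  have := sum_piAntidiag_eq_sum_powersetCard m b fun x =>
    if s.sum id + x = (a * (n + 1) + b * (m + 1)) / 2 + b * (b - 1) / 2 then 1 else 0
  rw [← this]
  refine sum_congr rfl fun ν _ => ?_
  rw [Nat.choose_two_right, ← add_assoc]
  simp

/-- Admissible monomials of degree `k` not involving the dual of `X_0`. -/
def monoms (n m k : ℕ) : Finset (Fin (n + 1) ⊕ Fin m → ℕ) :=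
  (piAntidiag univ k).filter fun μ => IsAdm (pL n m) μ ∧ μ (Sum.inl 0) = 0

/-- Twice the position of a basis vector in its `sl₂`-string, relative to the middle. -/
def genWt (n m : ℕ) : Fin (n + 1) ⊕ Fin m → ℤ :=
  Sum.elim (fun i => 2 * (i : ℤ) - (n + 1)) (fun j => 2 * ((j : ℤ) + 1) - (m + 1))

/-- The `sl₂`-weight of a monomial. -/
def wt (n m : ℕ) (μ : Fin (n + 1) ⊕ Fin m → ℕ) : ℤ := ∑ x, (μ x : ℤ) * genWt n m x

theorem mem_monoms {n m k : ℕ} {μ : Fin (n + 1) ⊕ Fin m → ℕ} :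
    μ ∈ monoms n m k ↔ deg μ = k ∧ IsAdm (pL n m) μ ∧ μ (Sum.inl 0) = 0 := by
  simp [monoms, deg]

theorem isAdm_pL {n m : ℕ} {μ : Fin (n + 1) ⊕ Fin m → ℕ} :
    IsAdm (pL n m) μ ↔ ∀ i, μ (Sum.inl i) ≤ 1 := by
  simp [IsAdm, pL]

theorem sum_indicator {n : ℕ} {s : Finset ℕ} (hs : s ⊆ Icc 1 n) (g : ℕ → ℕ) :
    ∑ i : Fin (n + 1), (if (i : ℕ) ∈ s then 1 else 0) * g i = ∑ i ∈ s, g i := by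
  rw [Fin.sum_univ_eq_sum_range (fun i => (if i ∈ s then 1 else 0) * g i)]
  simp only [ite_mul, one_mul, zero_mul]
  rw [← sum_filter, filter_mem_eq_inter, inter_eq_right.2]
  intro x hx
  have := mem_Icc.1 (hs hx)
  exact mem_range.2 (by omega)

theorem wt_elim (n m : ℕ) {s : Finset ℕ} (hs : s ⊆ Icc 1 n) (ν : Fin m → ℕ) :
    wt n m (Sum.elim (fun i => if (i : ℕ) ∈ s then 1 else 0) ν) =
      2 * ((s.sum id + ∑ j, ν j * ((j : ℕ) + 1) : ℕ) : ℤ) -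
        (s.card * (n + 1) + (∑ j, ν j : ℕ) * (m + 1) : ℕ) := by
  have key {ι : Type} [Fintype ι] (f g : ι → ℤ) (c : ℤ) :
      ∑ x, f x * (2 * g x - c) = 2 * ∑ x, f x * g x - (∑ x, f x) * c := by
    rw [mul_sum, sum_mul, ← sum_sub_distrib]
    exact sum_congr rfl fun x _ => by ring
  have h1 := sum_indicator hs id
  have h2 := sum_indicator hs fun _ => 1
  rw [← card_eq_sum_ones] at h2
  simp only [mul_one] at h2
  rw [← h1, ← h2, wt, Fintype.sum_sum_type]
  simp only [genWt, Sum.elim_inl, Sum.elim_inr, key, id]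
  push_cast
  ring

/-- The number of monomials of weight `0` or `-1`. -/
theorem card_monoms_filter (n m k : ℕ) :
    ((monoms n m k).filter fun μ => wt n m μ = 0 ∨ wt n m μ = -1).card =
      ∑ a ∈ range (k + 1), fnm n m a (k - a) := by
  simp only [fnm_eq_card]
  rw [← card_sigma]
  symm
  refine card_bij (fun x _ => Sum.elim (fun i => if (i : ℕ) ∈ x.2.1 then 1 else 0) x.2.2)
    ?_ ?_ ?_
  · rintro ⟨a, s, ν⟩ h
    simp only [mem_sigma, mem_filter, mem_product, mem_powersetCard, mem_piAntidiag, mem_range,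
      mem_univ, implies_true, and_true] at h
    obtain ⟨ha, ⟨⟨hs, hsa⟩, hν⟩, heq⟩ := h
    have h2 := sum_indicator hs fun _ => 1
    rw [← card_eq_sum_ones] at h2
    simp only [mul_one] at h2
    rw [mem_filter, mem_monoms, isAdm_pL, wt_elim n m hs]
    refine ⟨⟨?_, ?_, ?_⟩, ?_⟩
    · rw [deg, Fintype.sum_sum_type]
      simp only [Sum.elim_inl, Sum.elim_inr, h2, hν]
      omega
    · intro i
      simp only [Sum.elim_inl]
      split_ifs <;> simp
    · have : 0 ∉ s := fun h0 => by simpa using hs h0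
      simp [this]
    · rw [heq, hν, hsa]
      omega
  · rintro ⟨a, s, ν⟩ h ⟨a', s', ν'⟩ h' heq
    simp only [mem_sigma, mem_filter, mem_product, mem_powersetCard] at h h'
    obtain ⟨_, ⟨⟨hs, rfl⟩, _⟩, _⟩ := h
    obtain ⟨_, ⟨⟨hs', rfl⟩, _⟩, _⟩ := h'
    have hν : ν = ν' := by
      funext j
      exact congrFun heq (Sum.inr j)
    have hss : s = s' := by
      ext x
      by_cases hx : x < n + 1
      · have := congrFun heq (Sum.inl ⟨x, hx⟩)
        simp only [Sum.elim_inl] at this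
        by_cases h1 : x ∈ s <;> by_cases h2 : x ∈ s' <;> simp_all
      · constructor <;> intro h1
        · have := mem_Icc.1 (hs h1); omega
        · have := mem_Icc.1 (hs' h1); omega
    subst hν hss
    rfl
  · intro μ hμ
    rw [mem_filter, mem_monoms, isAdm_pL] at hμ
    obtain ⟨⟨hdeg, hadm, h0⟩, hw⟩ := hμ
    set s := (Icc 1 n).filter fun i => ∃ h : i < n + 1, μ (Sum.inl ⟨i, h⟩) = 1 with hsdef
    have hs : s ⊆ Icc 1 n := filter_subset _ _
    have hμ : Sum.elim (fun i : Fin (n + 1) => if (i : ℕ) ∈ s then 1 else 0)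
        (fun j => μ (Sum.inr j)) = μ := by
      funext x
      rcases x with i | j
      · have h1 := hadm i
        simp only [Sum.elim_inl]
        by_cases hi : i = 0
        · subst hi; simp [hsdef, h0]
        · have hi1 : 1 ≤ (i : ℕ) := Nat.one_le_iff_ne_zero.2 fun h => hi (Fin.ext h)
          have hi2 : (i : ℕ) ≤ n := by omega
          have : (i : ℕ) ∈ s ↔ μ (Sum.inl i) = 1 := by simp [hsdef, hi1, hi2]
          simp only [this]
          split_ifs <;> omega
      · rfl
    have h2 := sum_indicator hs fun _ => 1
    rw [← card_eq_sum_ones] at h2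
    simp only [mul_one] at h2
    have hk : s.card + ∑ j, μ (Sum.inr j) = k := by
      rw [← hdeg, deg, Fintype.sum_sum_type, ← h2]
      congr 1
      exact sum_congr rfl fun i _ => congrFun hμ (Sum.inl i)
    refine ⟨⟨s.card, s, fun j => μ (Sum.inr j)⟩, ?_, hμ⟩
    simp only [mem_sigma, mem_filter, mem_product, mem_powersetCard, mem_piAntidiag, mem_range,
      mem_univ, implies_true, and_true]
    refine ⟨by omega, ⟨hs, by omega⟩, ?_⟩
    rw [← hμ, wt_elim n m hs, show ∑ j, μ (Sum.inr j) = k - s.card by omega] at hw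
    omega

end Paper
end

noncomputable section
namespace SuperCE
open Finset

section Operators

variable {F : Type*} [Field F] {B : Type*}

theorem end_ext {f g : Module.End F (Cochain F B)}
    (h : ∀ μ, f (Finsupp.single μ 1) = g (Finsupp.single μ 1)) : f = g :=
  Finsupp.lhom_ext' fun μ => LinearMap.ext_ring (h μ)

variable [DecidableEq B]

/-- The annihilation operator at `b`: the derivative with respect to the generator `b`, without
Koszul sign. -/
def ann (F : Type*) [Field F] (b : B) : Module.End F (Cochain F B) :=
  Finsupp.lsum F fun μ => LinearMap.toSpanSingleton F (Cochain F B)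
    ((μ b : F) • Finsupp.single (fun x => μ x - eps b x) 1)

/-- The creation operator at `b`: multiplication by the generator `b`, without Koszul sign. -/
def cre (F : Type*) [Field F] (p : B → ℕ) (b : B) : Module.End F (Cochain F B) :=
  Finsupp.lsum F fun μ => LinearMap.toSpanSingleton F (Cochain F B)
    (if p b = 0 ∧ μ b ≠ 0 then 0 else Finsupp.single (fun x => μ x + eps b x) 1)

theorem ann_single (b : B) (μ : B → ℕ) :
    ann F b (Finsupp.single μ 1) = (μ b : F) • Finsupp.single (fun x => μ x - eps b x) 1 := by
  simp [ann]

theorem cre_single (p : B → ℕ) (b : B) (μ : B → ℕ) :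
    cre F p b (Finsupp.single μ 1) =
      if p b = 0 ∧ μ b ≠ 0 then 0 else Finsupp.single (fun x => μ x + eps b x) 1 := by
  simp [cre]

theorem ann_commute_ann (b c : B) : Commute (ann F b) (ann F c) := by
  rcases eq_or_ne b c with rfl | hbc
  · exact Commute.refl _
  · refine end_ext fun μ => ?_
    have h1 : (fun x => μ x - eps b x - eps c x) = fun x => μ x - eps c x - eps b x := by
      funext x; omega
    have h2 : eps b c = 0 := by simp [eps, hbc.symm]
    have h3 : eps c b = 0 := by simp [eps, hbc]
    simp only [Module.End.mul_apply, ann_single, map_smul, smul_smul, h1, h2, h3, Nat.sub_zero]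
    rw [mul_comm]

theorem cre_commute_cre (p : B → ℕ) (b c : B) : Commute (cre F p b) (cre F p c) := by
  rcases eq_or_ne b c with rfl | hbc
  · exact Commute.refl _
  · refine end_ext fun μ => ?_
    have h1 : (fun x => μ x + eps b x + eps c x) = fun x => μ x + eps c x + eps b x := by
      funext x; omega
    have h2 : eps b c = 0 := by simp [eps, hbc.symm]
    have h3 : eps c b = 0 := by simp [eps, hbc]
    rw [Module.End.mul_apply, Module.End.mul_apply, cre_single, cre_single]
    split_ifs with hc hb hb
    · rfl
    · rw [cre_single, map_zero, if_pos (by rwa [h2, add_zero])]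
    · rw [cre_single, map_zero, if_pos (by rwa [h3, add_zero])]
    · rw [cre_single, cre_single, h1, if_neg (by rwa [h3, add_zero]),
        if_neg (by rwa [h2, add_zero])]

theorem cre_commute_ann (p : B → ℕ) {b c : B} (hbc : b ≠ c) :
    Commute (cre F p b) (ann F c) := by
  refine end_ext fun μ => ?_
  have h2 : eps b c = 0 := by simp [eps, hbc.symm]
  have h3 : eps c b = 0 := by simp [eps, hbc]
  rw [Module.End.mul_apply, Module.End.mul_apply, cre_single, ann_single, map_smul, cre_single,
    h3, Nat.sub_zero]
  split_ifs
  · rw [map_zero, smul_zero]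
  · by_cases hc : μ c = 0
    · simp [hc, ann_single, h2]
    · rw [ann_single, h2, add_zero]
      congr 2
      funext x
      by_cases hx : x = c
      · subst hx; omega
      · simp [eps, hx]

theorem cre_ann_single {p μ : B → ℕ} (hμ : IsAdm p μ) (b : B) :
    cre F p b (ann F b (Finsupp.single μ 1)) = (μ b : F) • Finsupp.single μ 1 := by
  rw [ann_single, map_smul, cre_single]
  by_cases hb : μ b = 0
  · simp [hb]
  · have h1 : (fun x => μ x - eps b x + eps b x) = μ := by
      funext x
      by_cases hx : x = b
      · subst hx; simp [eps]; omega
      · simp [eps, hx]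
    have h2 : ¬(p b = 0 ∧ μ b - eps b b ≠ 0) := by
      rintro ⟨hp, hne⟩
      have := hμ b hp
      simp [eps] at hne
      omega
    rw [if_neg h2, h1]

theorem ann_cre_single {p μ : B → ℕ} (hμ : IsAdm p μ) (b : B) :
    ann F b (cre F p b (Finsupp.single μ 1)) =
      (if p b = 0 then 1 - μ b else μ b + 1 : F) • Finsupp.single μ 1 := by
  have h1 : (fun x => μ x + eps b x - eps b x) = μ := by funext x; simp
  rw [cre_single]
  by_cases hp : p b = 0
  · have := hμ b hp
    rcases Nat.le_one_iff_eq_zero_or_eq_one.1 this with h | h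
    · simp [h, ann_single, hp]
      simp [eps]
    · simp [h, hp]
  · simp [hp, ann_single]
    simp [eps]

/-- The shift operator replacing one generator `t` by the generator `s`. -/
def shift (F : Type*) [Field F] (p : B → ℕ) (s t : B) : Module.End F (Cochain F B) :=
  cre F p s * ann F t

theorem shift_single (p μ : B → ℕ) {s t : B} (hst : s ≠ t) :
    shift F p s t (Finsupp.single μ 1) =
      if μ t = 0 ∨ p s = 0 ∧ μ s ≠ 0 then 0
      else (μ t : F) • Finsupp.single (fun x => μ x - eps t x + eps s x) 1 := by
  have h : eps t s = 0 := by simp [eps, hst]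
  rw [shift, Module.End.mul_apply, ann_single, map_smul, cre_single, h, Nat.sub_zero]
  by_cases ht : μ t = 0
  · simp [ht]
  · by_cases hs : p s = 0 ∧ μ s ≠ 0 <;> simp [ht, hs]

theorem shift_commute_shift (p : B → ℕ) {s t s' t' : B} (hs : s ≠ s') (ht : t ≠ t') :
    Commute (shift F p s t) (shift F p t' s') :=
  ((cre_commute_cre p s t').mul_right (cre_commute_ann p hs)).mul_left
    (((cre_commute_ann p ht.symm).symm).mul_right (ann_commute_ann t s'))

theorem shift_shift_single {p μ : B → ℕ} (hμ : IsAdm p μ) {s t : B} (hst : s ≠ t)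
    (hp : p s = p t) :
    shift F p s t (shift F p t s (Finsupp.single μ 1)) =
      shift F p t s (shift F p s t (Finsupp.single μ 1)) +
        ((μ s : F) - μ t) • Finsupp.single μ 1 := by
  have key {s t : B} (hst : s ≠ t) : shift F p s t (shift F p t s (Finsupp.single μ 1)) =
      ((μ s : F) * (if p t = 0 then 1 - (μ t : F) else (μ t : F) + 1)) • Finsupp.single μ 1 := by
    have h1 : Commute (ann F s) (ann F t * cre F p t) :=
      (ann_commute_ann s t).mul_right (cre_commute_ann p hst.symm).symm
    have h2 : shift F p s t * shift F p t s = (cre F p s * ann F s) * (ann F t * cre F p t) := by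
      rw [shift, shift, mul_assoc, ← mul_assoc (ann F t), ← h1.eq, mul_assoc]
    rw [← Module.End.mul_apply, h2, Module.End.mul_apply, Module.End.mul_apply (ann F t),
      ann_cre_single hμ, map_smul, Module.End.mul_apply, cre_ann_single hμ, smul_smul, mul_comm]
  rw [key hst, key hst.symm, ← add_smul, hp]
  congr 1
  split_ifs <;> ring

variable {E : Type*} [Fintype E]

/-- The sum of the shifts along the edges `src e ← tgt e`, with weights `w`. -/
def shiftSum (p : B → ℕ) (w : E → F) (src tgt : E → B) : Module.End F (Cochain F B) :=
  ∑ e, w e • shift F p (src e) (tgt e)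

theorem shiftSum_comm_single {p μ : B → ℕ} (hμ : IsAdm p μ) {src tgt : E → B}
    (hsrc : Function.Injective src) (htgt : Function.Injective tgt)
    (hst : ∀ e, src e ≠ tgt e) (hp : ∀ e, p (src e) = p (tgt e)) (w : E → F) :
    shiftSum p 1 src tgt (shiftSum p w tgt src (Finsupp.single μ 1)) =
      shiftSum p w tgt src (shiftSum p 1 src tgt (Finsupp.single μ 1)) +
        (∑ e, w e * ((μ (src e) : F) - μ (tgt e))) • Finsupp.single μ 1 := by
  simp only [shiftSum, LinearMap.sum_apply, LinearMap.smul_apply, map_sum, map_smul,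
    Pi.one_apply, one_smul]
  rw [sum_comm, sum_smul, ← sub_eq_iff_eq_add', ← sum_sub_distrib]
  refine sum_congr rfl fun e _ => ?_
  rw [← smul_sum, ← smul_sub, ← sum_sub_distrib, mul_smul]
  congr 1
  rw [sum_eq_single e]
  · rw [shift_shift_single hμ (hst e) (hp e), add_sub_cancel_left]
  · intro e' _ he
    rw [sub_eq_zero]
    exact LinearMap.congr_fun
      (shift_commute_shift p (hsrc.ne he) (htgt.ne he)).eq (Finsupp.single μ 1)
  · simp

end Operators

section Sign

variable {F : Type*} [Field F] {B : Type*} [Fintype B] [DecidableEq B]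

theorem sgnProd_eps_add_eps (p ord μ : B → ℕ) (o l : B) :
    sgnProd F p ord μ (fun x => eps o x + eps l x) = (-1 : F) ^ (∑ x,
      ((if ord o < ord x then μ x * (1 + p x * p o) else 0) +
        if ord l < ord x then μ x * (1 + p x * p l) else 0)) := by
  rw [sgnProd]
  congr 1
  refine sum_congr rfl fun x _ => ?_
  have (y : B) : (if ord y < ord x then μ x * (eps o y + eps l y) * (1 + p x * p y) else 0) =
      (if y = o then (if ord o < ord x then μ x * (1 + p x * p o) else 0) else 0) +
      (if y = l then (if ord l < ord x then μ x * (1 + p x * p l) else 0) else 0) := by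
    by_cases h1 : y = o <;> by_cases h2 : y = l
    · subst h1; subst h2
      simp only [eps, if_true]
      split_ifs <;> ring
    · subst h1; simp [eps, h2]
    · subst h2; simp [eps, h1]
    · simp [eps, h1, h2]
  simp only [this, sum_add_distrib, sum_ite_eq', mem_univ, if_true]

/-- Replacing a generator `b` by its predecessor `l` and multiplying by the first generator `o`
involves no overall Koszul sign. -/
theorem koszul_sign_eq_one {p ord μ : B → ℕ} {o l b : B} (hord : Function.Injective ord)
    (ho : ord o = 0) (hpo : p o = 0) (hμo : μ o = 0) (hlo : ord l ≠ 0) (hb : ord b = ord l + 1)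
    (hb0 : μ b ≠ 0)
    (hp : p l = 0 ∧ p b = 0 ∧ μ l = 0 ∧ μ b = 1 ∨ ∀ x, ord l ≤ ord x → p x = 1) :
    ((-1 : F) ^ (∑ b', if ord b' < ord b then μ b' else 0)) *
      ((-1 : F) ^ ((μ b - 1) * p b)) *
      ((-1 : F) ^ (p b * ∑ b'', if ord b < ord b'' then μ b'' * p b'' else 0)) *
      sgnProd F p ord (fun x => μ x - eps b x) (fun x => eps o x + eps l x) = 1 := by
  rw [sgnProd_eps_add_eps, ← pow_add, ← pow_add, ← pow_add]
  have h1 : (μ b - 1) * p b = ∑ x, if x = b then (μ x - 1) * p x else 0 := by simp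
  rw [h1, mul_sum, ← sum_add_distrib, ← sum_add_distrib, ← sum_add_distrib]
  refine Even.neg_one_pow (even_sum _ fun x _ => ?_)
  have hxo : ord x = 0 → x = o := fun h => hord (h.trans ho.symm)
  have hxb : ord x = ord b → x = b := fun h => hord h
  have hxl : ord x = ord l → x = l := fun h => hord h
  by_cases hx0 : ord x = 0
  · obtain rfl := hxo hx0
    have : x ≠ b := by rintro rfl; omega
    simp [ho, hμo, this]
  by_cases hx1 : x = b
  · subst hx1
    rcases hp with ⟨h3, h4, h5, h6⟩ | h3
    · simp [h4, h6, eps]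
    · have h4 := h3 x (by omega)
      have h5 := h3 l le_rfl
      simp only [lt_irrefl, if_false, if_true, h4, h5, hpo, ho, eps, hb]
      simp
      exact ⟨2 * (μ x - 1), by omega⟩
  have hx2 : ord x ≠ ord b := fun h => hx1 (hxb h)
  have hx3 : ord o < ord x := by omega
  simp only [hx1, eps, if_false, hpo, hx3, if_true, Nat.sub_zero]
  by_cases hx4 : ord x < ord b
  · have h5 : ¬ ord b < ord x := by omega
    by_cases hx6 : x = l
    · subst hx6
      rcases hp with ⟨h3, h4, h5, h6⟩ | h3
      · simp [h5]
      · simp [hx4, h5]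
    · have : ord x ≠ ord l := fun h => hx6 (hxl h)
      have : ¬ ord l < ord x := by omega
      simp [hx4, h5, this]
  · have h5 : ord b < ord x := by omega
    have h6 : ord l < ord x := by omega
    rcases hp with ⟨h3, h4, _, _⟩ | h3
    · simp [hx4, h3, h4, h6]
    · simp only [hx4, h5, h6, h3 x (by omega), h3 l le_rfl, h3 b (by omega), if_true, if_false]
      exact ⟨2 * μ x, by omega⟩

end Sign

end SuperCE
end

noncomputable section
namespace Paper
open SuperCE SlTwo Finset

variable (F : Type*) [Field F]

/-- Indices of the basis vectors `x` such that `[X_0, x]` is a basis vector. -/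
def edgeSrc (N M : ℕ) : Fin N ⊕ Fin M → Fin (N + 1 + 1) ⊕ Fin (M + 1) :=
  Sum.map (fun e => e.castSucc.succ) Fin.castSucc

/-- Indices of the basis vectors of the form `[X_0, x]`. -/
def edgeTgt (N M : ℕ) : Fin N ⊕ Fin M → Fin (N + 1 + 1) ⊕ Fin (M + 1) :=
  Sum.map (fun e => e.succ.succ) Fin.succ

/-- Matrix entries of the raising operator of the `sl₂`-representation. -/
def edgeWt (N M : ℕ) : Fin N ⊕ Fin M → F :=
  Sum.elim (fun e => ((e : ℕ) + 1) * ((N : F) - (e : ℕ)))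
    (fun e => ((e : ℕ) + 1) * ((M : F) - (e : ℕ)))

/-- The lowering operator: the coadjoint action of `X_0`. -/
def lowering (N M : ℕ) : Module.End F (Cochain F (Fin (N + 1 + 1) ⊕ Fin (M + 1))) :=
  shiftSum (pL (N + 1) (M + 1)) 1 (edgeSrc N M) (edgeTgt N M)

/-- The raising operator. -/
def raising (N M : ℕ) : Module.End F (Cochain F (Fin (N + 1 + 1) ⊕ Fin (M + 1))) :=
  shiftSum (pL (N + 1) (M + 1)) (edgeWt F N M) (edgeTgt N M) (edgeSrc N M)

variable {F}

theorem edgeSrc_injective (N M : ℕ) : Function.Injective (edgeSrc N M) :=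
  Function.Injective.sumMap ((Fin.succ_injective _).comp (Fin.castSucc_injective _))
    (Fin.castSucc_injective _)

theorem edgeTgt_injective (N M : ℕ) : Function.Injective (edgeTgt N M) :=
  Function.Injective.sumMap ((Fin.succ_injective _).comp (Fin.succ_injective _))
    (Fin.succ_injective _)

theorem edgeSrc_ne_zero {N M : ℕ} (e : Fin N ⊕ Fin M) : edgeSrc N M e ≠ Sum.inl 0 := by
  rcases e with e | e <;> simp [edgeSrc]

theorem edgeTgt_ne_zero {N M : ℕ} (e : Fin N ⊕ Fin M) : edgeTgt N M e ≠ Sum.inl 0 := by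
  rcases e with e | e <;> simp [edgeTgt]

theorem edgeSrc_ne_edgeTgt {N M : ℕ} (e : Fin N ⊕ Fin M) : edgeSrc N M e ≠ edgeTgt N M e := by
  rcases e with e | e <;> simp [edgeSrc, edgeTgt, Fin.ext_iff]

theorem pL_edgeSrc {N M : ℕ} (e : Fin N ⊕ Fin M) :
    pL (N + 1) (M + 1) (edgeSrc N M e) = pL (N + 1) (M + 1) (edgeTgt N M e) := by
  rcases e with e | e <;> rfl

theorem genWt_edgeTgt {N M : ℕ} (e : Fin N ⊕ Fin M) :
    genWt (N + 1) (M + 1) (edgeTgt N M e) = genWt (N + 1) (M + 1) (edgeSrc N M e) + 2 := by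
  rcases e with e | e <;> simp [edgeSrc, edgeTgt, genWt] <;> ring

/-- Replacing a factor `t` of a monomial by `s`. -/
theorem sum_replace {B R : Type*} [Fintype B] [DecidableEq B] [CommRing R] {μ : B → ℕ} {s t : B}
    (ht : μ t ≠ 0) (g : B → R) :
    ∑ x, ((μ x - eps t x + eps s x : ℕ) : R) * g x = ∑ x, (μ x : R) * g x + g s - g t := by
  have h (x : B) : ((μ x - eps t x + eps s x : ℕ) : R) * g x =
      (μ x : R) * g x + (if x = s then g x else 0) - (if x = t then g x else 0) := by
    have hle : eps t x ≤ μ x := by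
      by_cases hx : x = t
      · subst hx; simp [eps]; omega
      · simp [eps, hx]
    rw [Nat.cast_add, Nat.cast_sub hle]
    simp only [eps]
    split_ifs <;> push_cast <;> ring
  simp only [h, sum_add_distrib, sum_sub_distrib, sum_ite_eq', mem_univ, if_true]

theorem shift_mem_wtSpace {n m k : ℕ} {μ : Fin (n + 1) ⊕ Fin m → ℕ} (hμ : μ ∈ monoms n m k)
    {s t : Fin (n + 1) ⊕ Fin m} (hs : s ≠ Sum.inl 0) (hst : s ≠ t) :
    shift F (pL n m) s t (Finsupp.single μ 1) ∈
      wtSpace (monoms n m k) (wt n m) F (wt n m μ + genWt n m s - genWt n m t) := by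
  rw [shift_single _ _ hst]
  split_ifs with h
  · exact zero_mem _
  · push Not at h
    obtain ⟨ht, hs'⟩ := h
    refine Submodule.smul_mem _ _ (Finsupp.single_mem_supported F 1 ⟨?_, ?_⟩)
    · rw [mem_monoms] at hμ ⊢
      obtain ⟨hk, hadm, h0⟩ := hμ
      refine ⟨?_, ?_, ?_⟩
      · have := sum_replace (R := ℤ) (s := s) ht 1
        simp only [Pi.one_apply, mul_one, add_sub_cancel_right] at this
        rw [← hk, deg, deg]
        exact_mod_cast this
      · intro b hb
        have := hadm b hb
        by_cases hbs : b = s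
        · subst hbs
          simp [eps, hs' hb]
        · simp [eps, hbs]
          omega
      · simp [eps, h0, hs.symm]
    · exact sum_replace ht _

theorem sum_edge (N : ℕ) (f : Fin (N + 1) → F) :
    ∑ e : Fin N, (((e : ℕ) + 1) * ((N : F) - (e : ℕ))) * (f e.castSucc - f e.succ) =
      ∑ i : Fin (N + 1), f i * ((N : F) - 2 * (i : ℕ)) := by
  have h1 : ∑ i : Fin (N + 1), (((i : ℕ) + 1) * ((N : F) - (i : ℕ))) * f i =
      ∑ e : Fin N, (((e : ℕ) + 1) * ((N : F) - (e : ℕ))) * f e.castSucc := by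
    simp [Fin.sum_univ_castSucc]
  have h2 : ∑ i : Fin (N + 1), (((i : ℕ) : F) * ((N : F) - (i : ℕ) + 1)) * f i =
      ∑ e : Fin N, (((e : ℕ) + 1) * ((N : F) - (e : ℕ))) * f e.succ := by
    rw [Fin.sum_univ_succ, Fin.val_zero, Nat.cast_zero, zero_mul, zero_mul, zero_add]
    refine sum_congr rfl fun e _ => ?_
    rw [Fin.val_succ]
    push_cast
    ring
  simp only [mul_sub _ (f _) (f _), sum_sub_distrib]
  rw [← h1, ← h2, ← sum_sub_distrib]
  exact sum_congr rfl fun i _ => by ring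

theorem sum_edgeWt {N M : ℕ} {μ : Fin (N + 1 + 1) ⊕ Fin (M + 1) → ℕ} (h0 : μ (Sum.inl 0) = 0) :
    ∑ e, edgeWt F N M e * ((μ (edgeSrc N M e) : F) - μ (edgeTgt N M e)) =
      -(wt (N + 1) (M + 1) μ : F) := by
  have hX := sum_edge N fun i => (μ (Sum.inl i.succ) : F)
  have hY := sum_edge M fun i => (μ (Sum.inr i) : F)
  rw [Fintype.sum_sum_type]
  simp only [edgeWt, edgeSrc, edgeTgt, Sum.elim_inl, Sum.elim_inr, Sum.map_inl, Sum.map_inr]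
  rw [hX, hY, wt, Fintype.sum_sum_type,
    Fin.sum_univ_succ fun i => (μ (Sum.inl i) : ℤ) * genWt (N + 1) (M + 1) (Sum.inl i), h0]
  push_cast
  rw [zero_mul, zero_add, neg_add, ← sum_neg_distrib, ← sum_neg_distrib]
  congr 1 <;> refine sum_congr rfl fun i _ => ?_
  · simp [genWt]; ring
  · simp [genWt]; ring

theorem isLoweringRaising (N M k : ℕ) :
    IsLoweringRaising (monoms (N + 1) (M + 1) k) (wt (N + 1) (M + 1))
      (lowering F N M) (raising F N M) where
  lower μ hμ := by
    rw [lowering, shiftSum, LinearMap.sum_apply]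
    refine Submodule.sum_mem _ fun e _ => Submodule.smul_mem _ _ ?_
    have := shift_mem_wtSpace (F := F) hμ (edgeSrc_ne_zero e) (edgeSrc_ne_edgeTgt e)
    rwa [genWt_edgeTgt, show ∀ a b : ℤ, a + b - (b + 2) = a - 2 by intros; ring] at this
  raise μ hμ := by
    rw [raising, shiftSum, LinearMap.sum_apply]
    refine Submodule.sum_mem _ fun e _ => Submodule.smul_mem _ _ ?_
    have := shift_mem_wtSpace (F := F) hμ (edgeTgt_ne_zero e) (edgeSrc_ne_edgeTgt e).symm
    rwa [genWt_edgeTgt, show ∀ a b : ℤ, a + (b + 2) - b = a + 2 by intros; ring] at this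
  comm μ hμ := by
    obtain ⟨-, hadm, h0⟩ := mem_monoms.1 hμ
    rw [lowering, raising, shiftSum_comm_single hadm (edgeSrc_injective N M)
      (edgeTgt_injective N M) edgeSrc_ne_edgeTgt pL_edgeSrc, sum_edgeWt h0, neg_smul,
      sub_eq_add_neg]

theorem ordL_injective (n m : ℕ) : Function.Injective (ordL n m) := by
  rintro (i | i) (j | j) h <;> simp [ordL] at h ⊢ <;> omega

theorem ordL_edgeTgt {N M : ℕ} (e : Fin N ⊕ Fin M) :
    ordL (N + 1) (M + 1) (edgeTgt N M e) = ordL (N + 1) (M + 1) (edgeSrc N M e) + 1 := by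
  rcases e with e | e <;> simp [edgeSrc, edgeTgt, ordL]; omega

theorem ordL_edgeSrc_ne_zero {N M : ℕ} (e : Fin N ⊕ Fin M) :
    ordL (N + 1) (M + 1) (edgeSrc N M e) ≠ 0 := by
  rcases e with e | e <;> simp [edgeSrc, ordL]

theorem dcoef_edge {N M : ℕ} (e : Fin N ⊕ Fin M) :
    dcoef F (pL (N + 1) (M + 1)) (ordL (N + 1) (M + 1)) (cL F (N + 1) (M + 1))
      (edgeTgt N M e) (Sum.inl 0) (edgeSrc N M e) = 1 := by
  have h : ordL (N + 1) (M + 1) (Sum.inl 0) < ordL (N + 1) (M + 1) (edgeSrc N M e) :=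
    Nat.pos_of_ne_zero (ordL_edgeSrc_ne_zero e)
  rw [dcoef, if_pos h]
  rcases e with e | e <;> simp [edgeSrc, edgeTgt, cL, pL]

theorem exists_edge_of_dcoef_ne_zero {N M : ℕ} {b k l : Fin (N + 1 + 1) ⊕ Fin (M + 1)}
    (h : dcoef F (pL (N + 1) (M + 1)) (ordL (N + 1) (M + 1)) (cL F (N + 1) (M + 1)) b k l ≠ 0) :
    ∃ e, edgeTgt N M e = b ∧ Sum.inl 0 = k ∧ edgeSrc N M e = l := by
  rw [dcoef] at h
  split_ifs at h with h1 h2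
  · have hc := right_ne_zero_of_mul h
    rcases k with k | k <;> rcases l with l | l <;> rcases b with b | b <;>
      simp only [cL, ne_eq, not_true_eq_false] at hc
    · simp only [ordL, Sum.elim_inl] at h1
      split_ifs at hc with h3 h4
      · refine ⟨Sum.inl ⟨l - 1, by omega⟩, ?_, ?_, ?_⟩ <;>
          simp [edgeTgt, edgeSrc, Fin.ext_iff] <;> omega
      · omega
      · exact absurd rfl hc
    · split_ifs at hc with h3
      · refine ⟨Sum.inr ⟨l, by omega⟩, ?_, ?_, ?_⟩ <;>
          simp [edgeTgt, edgeSrc, Fin.ext_iff] <;> omega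
      · exact absurd rfl hc
    · simp only [ordL, Sum.elim_inl, Sum.elim_inr] at h1
      omega
  · obtain ⟨rfl, hp⟩ := h2
    rcases k with k | k
    · simp [pL] at hp
    · rcases b with b | b <;> simp [cL] at h
  · exact absurd rfl h

/-- On admissible monomials, the differential is the lowering operator followed by
multiplication by the dual of `X_0`. -/
theorem d_single {N M : ℕ} {μ : Fin (N + 1 + 1) ⊕ Fin (M + 1) → ℕ}
    (hμ : IsAdm (pL (N + 1) (M + 1)) μ) :
    SuperCE.d F (pL (N + 1) (M + 1)) (ordL (N + 1) (M + 1)) (cL F (N + 1) (M + 1))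
      (Finsupp.single μ 1) =
    cre F (pL (N + 1) (M + 1)) (Sum.inl 0) (lowering F N M (Finsupp.single μ 1)) := by
  have hd : SuperCE.d F (pL (N + 1) (M + 1)) (ordL (N + 1) (M + 1)) (cL F (N + 1) (M + 1))
      (Finsupp.single μ 1) =
      dMono F (pL (N + 1) (M + 1)) (ordL (N + 1) (M + 1)) (cL F (N + 1) (M + 1)) μ := by
    simp [SuperCE.d]
  rw [hd, dMono, lowering, shiftSum, LinearMap.sum_apply, map_sum]
  simp only [← sum_product']
  symm
  refine sum_of_injOn (fun e => (edgeTgt N M e, Sum.inl 0, edgeSrc N M e)) ?_ ?_ ?_ ?_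
  · intro e _ e' _ h
    exact edgeTgt_injective N M (Prod.ext_iff.1 h).1
  · intro e _
    simp
  · rintro ⟨b, k, l⟩ _ hne
    by_contra h
    have hc : dcoef F (pL (N + 1) (M + 1)) (ordL (N + 1) (M + 1)) (cL F (N + 1) (M + 1))
        b k l ≠ 0 := by
      intro hc
      simp [hc] at h
    obtain ⟨e, h1, h2, h3⟩ := exists_edge_of_dcoef_ne_zero hc
    exact hne ⟨e, by simp, by simp [h1, h2, h3]⟩
  · intro e _
    set b := edgeTgt N M e
    set l := edgeSrc N M e
    have hlb : l ≠ b := edgeSrc_ne_edgeTgt e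
    have hl0 : l ≠ Sum.inl 0 := edgeSrc_ne_zero e
    have hb0 : b ≠ Sum.inl 0 := edgeTgt_ne_zero e
    have hpl : pL (N + 1) (M + 1) l = pL (N + 1) (M + 1) b := pL_edgeSrc e
    rw [Pi.one_apply, one_smul, shift_single _ _ hlb]
    by_cases hb : μ b = 0
    · simp [hb]
    have htgt : tgt μ b (Sum.inl 0) l =
        fun x => μ x - eps b x + eps l x + eps (Sum.inl 0) x := by
      funext x
      simp only [tgt]
      ring
    have hadm : IsAdm (pL (N + 1) (M + 1)) (tgt μ b (Sum.inl 0) l) ↔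
        μ (Sum.inl 0) = 0 ∧ (pL (N + 1) (M + 1) l = 0 → μ l = 0) := by
      rw [htgt]
      constructor
      · intro h
        constructor
        · have := h (Sum.inl 0) rfl
          simp [eps, hl0.symm, hb0.symm] at this
          exact this
        · intro hp
          have := h l hp
          simp [eps, hl0, hlb] at this
          exact this
      · rintro ⟨h0, hl⟩ x hx
        by_cases hx0 : x = Sum.inl 0
        · subst hx0
          simp [eps, hl0.symm, h0]
        · by_cases hxl : x = l
          · rw [hxl] at hx ⊢
            simp [eps, hl hx, hl0]
          · have := hμ x hx
            simp [eps, hx0, hxl]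
            omega
    by_cases hs : pL (N + 1) (M + 1) l = 0 ∧ μ l ≠ 0
    · rw [if_pos (Or.inr hs), map_zero, if_neg]
      rw [hadm]
      rintro ⟨-, -, h⟩
      exact hs.2 (h hs.1)
    rw [if_neg (by tauto), map_smul, cre_single]
    by_cases h0 : μ (Sum.inl 0) = 0
    · have h0' : μ (Sum.inl 0) - eps b (Sum.inl 0) + eps l (Sum.inl 0) = 0 := by
        simp [eps, h0, hl0.symm]
      rw [if_neg (by rw [h0']; simp), if_pos ⟨hb, hadm.2 ⟨h0, by tauto⟩⟩, htgt, dcoef_edge,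
        Finsupp.smul_single, smul_eq_mul, mul_one, mul_one]
      congr 1
      have hsign := koszul_sign_eq_one (F := F) (p := pL (N + 1) (M + 1)) (μ := μ) (b := b)
        (l := l) (o := Sum.inl 0) (ordL_injective (N + 1) (M + 1)) rfl rfl h0
        (ordL_edgeSrc_ne_zero e) (ordL_edgeTgt e) hb ?_
      · rw [mul_right_comm _ (μ b : F), mul_right_comm _ (μ b : F), mul_right_comm _ (μ b : F),
          hsign, one_mul]
      · rcases e with e | e
        · left
          have hpb : pL (N + 1) (M + 1) b = 0 := rfl
          have := hμ b hpb
          exact ⟨rfl, rfl, by tauto, by omega⟩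
        · right
          rintro (x | x) hx
          · simp [l, ordL, edgeSrc] at hx
            omega
          · rfl
    · have h0' : μ (Sum.inl 0) - eps b (Sum.inl 0) + eps l (Sum.inl 0) ≠ 0 := by
        simp [eps, h0, hl0.symm, hb0.symm]
      rw [if_pos ⟨rfl, h0'⟩, if_neg, smul_zero]
      rw [hadm]
      tauto

end Paper
end

noncomputable section
namespace Paper
open SuperCE SlTwo Finset

/-- Admissible monomials of degree `k`. -/
def admMonoms (n m k : ℕ) : Finset (Fin (n + 1) ⊕ Fin m → ℕ) :=
  (piAntidiag univ k).filter fun μ => IsAdm (pL n m) μ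

theorem mem_admMonoms {n m k : ℕ} {μ : Fin (n + 1) ⊕ Fin m → ℕ} :
    μ ∈ admMonoms n m k ↔ IsAdm (pL n m) μ ∧ deg μ = k := by
  simp [admMonoms, deg, and_comm]

theorem monoms_subset (n m k : ℕ) : monoms n m k ⊆ admMonoms n m k := fun μ hμ => by
  rw [mem_monoms] at hμ
  exact mem_admMonoms.2 ⟨hμ.2.1, hμ.1⟩

theorem AdmDeg_eq_supported (F : Type*) [Field F] (n m k : ℕ) :
    AdmDeg F (pL n m) k = Finsupp.supported F F (admMonoms n m k : Set _) := by
  ext f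
  simp only [Finsupp.mem_supported, Set.subset_def, Finset.mem_coe, Finsupp.mem_support_iff,
    mem_admMonoms]
  rfl

theorem deg_add_eps {B : Type*} [Fintype B] [DecidableEq B] (μ : B → ℕ) (b : B) :
    deg (fun x => μ x + eps b x) = deg μ + 1 := by
  simp [deg, eps, sum_add_distrib]

theorem isAdm_add_eps_zero {n m : ℕ} {μ : Fin (n + 1) ⊕ Fin m → ℕ} (hμ : IsAdm (pL n m) μ)
    (h0 : μ (Sum.inl 0) = 0) : IsAdm (pL n m) fun x => μ x + eps (Sum.inl 0) x := by
  intro x hx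
  by_cases hx0 : x = Sum.inl 0
  · subst hx0; simp [eps, h0]
  · simpa [eps, hx0] using hμ x hx

theorem card_admMonoms_zero (n m : ℕ) : (admMonoms n m 0).card = (monoms n m 0).card := by
  congr 1
  refine Subset.antisymm (fun μ hμ => ?_) (monoms_subset n m 0)
  rw [mem_admMonoms] at hμ
  exact mem_monoms.2 ⟨hμ.2, hμ.1, sum_eq_zero_iff.1 hμ.2 _ (mem_univ _)⟩

theorem card_admMonoms_succ (n m k : ℕ) :
    (admMonoms n m (k + 1)).card = (monoms n m (k + 1)).card + (monoms n m k).card := by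
  rw [← card_filter_add_card_filter_not (s := admMonoms n m (k + 1))
    (fun μ => μ (Sum.inl 0) = 0)]
  congr 1
  · congr 1
    ext μ
    rw [mem_filter, mem_admMonoms, mem_monoms]
    tauto
  · symm
    refine card_nbij' (fun μ x => μ x + eps (Sum.inl 0) x) (fun μ x => μ x - eps (Sum.inl 0) x)
      ?_ ?_ ?_ ?_
    · intro μ hμ
      obtain ⟨hk, hadm, h0⟩ := mem_monoms.1 hμ
      rw [mem_coe, mem_filter, mem_admMonoms, deg_add_eps, hk]
      exact ⟨⟨isAdm_add_eps_zero hadm h0, rfl⟩, by simp [eps]⟩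
    · intro μ hμ
      rw [mem_coe, mem_filter, mem_admMonoms] at hμ
      obtain ⟨⟨hadm, hk⟩, h0⟩ := hμ
      have h1 : (fun x => μ x - eps (Sum.inl 0) x + eps (Sum.inl 0) x) = μ := by
        funext x
        by_cases hx : x = Sum.inl 0
        · subst hx; simp [eps]; omega
        · simp [eps, hx]
      have h2 := deg_add_eps (fun x => μ x - eps (Sum.inl 0) x) (Sum.inl 0)
      rw [h1] at h2
      have h3 := hadm (Sum.inl 0) rfl
      refine mem_monoms.2 ⟨Nat.succ_injective (h2.symm.trans hk),
        fun x hx => (Nat.sub_le _ _).trans (hadm x hx), ?_⟩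
      simp [eps]
      omega
    · intro μ _
      simp
    · intro μ hμ
      have h0 := (mem_filter.1 hμ).2
      funext x
      by_cases hx : x = Sum.inl 0
      · subst hx; simp [eps]; omega
      · simp [eps, hx]

section Differential

variable {F : Type*} [Field F] (N M : ℕ)

/-- Multiplication by the dual of `X_0`. -/
abbrev creZero (F : Type*) [Field F] (N M : ℕ) :
    Module.End F (Cochain F (Fin (N + 1 + 1) ⊕ Fin (M + 1))) :=
  cre F (pL (N + 1) (M + 1)) (Sum.inl 0)

/-- The Chevalley–Eilenberg differential of the model filiform Lie superalgebra. -/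
abbrev diff (F : Type*) [Field F] (N M : ℕ) :
    Module.End F (Cochain F (Fin (N + 1 + 1) ⊕ Fin (M + 1))) :=
  SuperCE.d F (pL (N + 1) (M + 1)) (ordL (N + 1) (M + 1)) (cL F (N + 1) (M + 1))

/-- Cochains of degree `k` not involving the dual of `X_0`. -/
abbrev monomSpan (F : Type*) [Field F] (N M k : ℕ) :
    Submodule F (Cochain F (Fin (N + 1 + 1) ⊕ Fin (M + 1))) :=
  Finsupp.supported F F (monoms (N + 1) (M + 1) k : Set _)

theorem creZero_commute_lowering : Commute (creZero F N M) (lowering F N M) := by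
  refine Commute.sum_right _ _ _ fun e _ => Commute.smul_right ?_ _
  exact (cre_commute_cre _ _ _).mul_right (cre_commute_ann _ (edgeTgt_ne_zero e).symm)

theorem creZero_creZero (f : Cochain F (Fin (N + 1 + 1) ⊕ Fin (M + 1))) :
    creZero F N M (creZero F N M f) = 0 := by
  have : creZero F N M * creZero F N M = 0 := by
    refine end_ext fun μ => ?_
    rw [Module.End.mul_apply, cre_single]
    split_ifs
    · simp
    · rw [cre_single, if_pos ⟨rfl, by simp [eps]⟩]
      rfl
  exact LinearMap.congr_fun this f

variable {N M}

theorem creZero_mem_AdmDeg {k : ℕ} {v : Cochain F (Fin (N + 1 + 1) ⊕ Fin (M + 1))}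
    (hv : v ∈ monomSpan F N M k) :
    creZero F N M v ∈ AdmDeg F (pL (N + 1) (M + 1)) (k + 1) := by
  refine map_mem_of_single (fun μ hμ => ?_) hv
  obtain ⟨hk, hadm, h0⟩ := mem_monoms.1 hμ
  rw [cre_single, if_neg (by simp [h0]), AdmDeg_eq_supported]
  refine Finsupp.single_mem_supported F 1 ?_
  rw [mem_coe, mem_admMonoms, deg_add_eps, hk]
  exact ⟨isAdm_add_eps_zero hadm h0, rfl⟩

theorem eq_zero_of_creZero_eq_zero {k : ℕ} {v : Cochain F (Fin (N + 1 + 1) ⊕ Fin (M + 1))}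
    (hv : v ∈ monomSpan F N M k) (h : creZero F N M v = 0) : v = 0 := by
  have : ann F (Sum.inl 0) (creZero F N M v) = v := by
    refine map_eq_of_single (f := ann F (Sum.inl 0) ∘ₗ creZero F N M) (g := LinearMap.id)
      (fun μ hμ => ?_) hv
    obtain ⟨-, hadm, h0⟩ := mem_monoms.1 hμ
    rw [LinearMap.comp_apply, ann_cre_single hadm,
      if_pos (show pL (N + 1) (M + 1) (Sum.inl 0) = 0 from rfl), h0]
    simp
  rw [← this, h, map_zero]

theorem lowering_mem_monomSpan {k : ℕ} {v : Cochain F (Fin (N + 1 + 1) ⊕ Fin (M + 1))}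
    (hv : v ∈ monomSpan F N M k) : lowering F N M v ∈ monomSpan F N M k :=
  map_mem_of_single (fun μ hμ => Finsupp.supported_mono (fun _ h => h.1)
    ((isLoweringRaising N M k).lower μ hμ)) hv

theorem diff_eq {k : ℕ} {v : Cochain F (Fin (N + 1 + 1) ⊕ Fin (M + 1))}
    (hv : v ∈ AdmDeg F (pL (N + 1) (M + 1)) k) :
    diff F N M v = creZero F N M (lowering F N M v) := by
  rw [AdmDeg_eq_supported] at hv
  exact map_eq_of_single (f := diff F N M) (g := creZero F N M ∘ₗ lowering F N M)
    (fun μ hμ => d_single (mem_admMonoms.1 hμ).1) hv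

theorem map_diff_AdmDeg (k : ℕ) :
    (AdmDeg F (pL (N + 1) (M + 1)) k).map (diff F N M) =
      (monomSpan F N M k).map (creZero F N M ∘ₗ lowering F N M) := by
  apply le_antisymm
  · rintro _ ⟨v, hv, rfl⟩
    rw [SetLike.mem_coe, AdmDeg_eq_supported] at hv
    refine map_mem_of_single (fun μ hμ => ?_) hv
    obtain ⟨hadm, hk⟩ := mem_admMonoms.1 hμ
    rw [d_single hadm]
    by_cases h0 : μ (Sum.inl 0) = 0
    · exact ⟨_, Finsupp.single_mem_supported F 1 (mem_monoms.2 ⟨hk, hadm, h0⟩), rfl⟩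
    · have : creZero F N M (lowering F N M (Finsupp.single μ 1)) =
          lowering F N M (creZero F N M (Finsupp.single μ 1)) :=
        LinearMap.congr_fun (creZero_commute_lowering N M).eq _
      rw [this, cre_single, if_pos ⟨rfl, h0⟩, map_zero]
      exact zero_mem _
  · rintro _ ⟨v, hv, rfl⟩
    have : v ∈ AdmDeg F (pL (N + 1) (M + 1)) k := by
      rw [AdmDeg_eq_supported]
      exact Finsupp.supported_mono (coe_subset.2 (monoms_subset _ _ _)) hv
    exact ⟨v, this, diff_eq this⟩

theorem map_diff_AdmDeg_le (k : ℕ) :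
    (AdmDeg F (pL (N + 1) (M + 1)) k).map (diff F N M) ≤
      AdmDeg F (pL (N + 1) (M + 1)) (k + 1) := by
  rw [map_diff_AdmDeg]
  rintro _ ⟨v, hv, rfl⟩
  exact creZero_mem_AdmDeg (lowering_mem_monomSpan hv)

theorem map_diff_AdmDeg_le_ker (k : ℕ) :
    (AdmDeg F (pL (N + 1) (M + 1)) k).map (diff F N M) ≤ LinearMap.ker (diff F N M) := by
  intro w hw
  have hw' := map_diff_AdmDeg_le k hw
  rw [map_diff_AdmDeg] at hw
  obtain ⟨v, -, rfl⟩ := hw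
  rw [LinearMap.mem_ker, diff_eq hw', LinearMap.comp_apply]
  have : creZero F N M (lowering F N M (creZero F N M (lowering F N M v))) =
      lowering F N M (creZero F N M (creZero F N M (lowering F N M v))) :=
    LinearMap.congr_fun (creZero_commute_lowering N M).eq _
  rw [this, creZero_creZero, map_zero]

instance (k : ℕ) : FiniteDimensional F (AdmDeg F (pL (N + 1) (M + 1)) k) := by
  rw [AdmDeg_eq_supported]
  infer_instance

theorem finrank_Zk_add (k : ℕ) :
    Module.finrank F ((AdmDeg F (pL (N + 1) (M + 1)) k).map (diff F N M)) +
      Module.finrank F (Zk F (pL (N + 1) (M + 1)) (ordL (N + 1) (M + 1)) (cL F (N + 1) (M + 1)) k) =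
      (admMonoms (N + 1) (M + 1) k).card := by
  rw [Zk, finrank_map_add_finrank_inf_ker, AdmDeg_eq_supported, finrank_supported]

theorem finrank_map_diff_add [CharZero F] (k : ℕ) :
    Module.finrank F ((AdmDeg F (pL (N + 1) (M + 1)) k).map (diff F N M)) +
      ∑ a ∈ range (k + 1), fnm (N + 1) (M + 1) a (k - a) = (monoms (N + 1) (M + 1) k).card := by
  have : monomSpan F N M k ⊓ LinearMap.ker (lowering F N M) =
      monomSpan F N M k ⊓ LinearMap.ker (creZero F N M ∘ₗ lowering F N M) := by
    ext v
    simp only [Submodule.mem_inf, LinearMap.mem_ker, LinearMap.comp_apply]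
    refine and_congr_right fun hv => ⟨fun h => by rw [h, map_zero], fun h => ?_⟩
    exact eq_zero_of_creZero_eq_zero (lowering_mem_monomSpan hv) h
  rw [map_diff_AdmDeg, ← card_monoms_filter, ← (isLoweringRaising (F := F) N M k).finrank_ker,
    ← finrank_supported (F := F) (monoms (N + 1) (M + 1) k),
    ← finrank_map_add_finrank_inf_ker (creZero F N M ∘ₗ lowering F N M) (monomSpan F N M k)]
  rw [← this]

end Differential

/-- The Betti numbers of the model filiform Lie superalgebra `L_{n,m}`
over an algebraically closed field of characteristic zero:
`dim H^k(L_{n,m}) = ∑_{k₀=0}^{k} f_{n,m}(k₀, k-k₀) + ∑_{k₀=0}^{k-1} f_{n,m}(k₀, k-k₀-1)`. -/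
theorem betti_numbers_model_filiform
    (F : Type*) [Field F] [IsAlgClosed F] [CharZero F]
    (n m : ℕ) (hn : 1 ≤ n) (hm : 1 ≤ m) (k : ℕ) :
    Hdim F (pL n m) (ordL n m) (cL F n m) k =
      (∑ k0 ∈ Finset.range (k + 1), fnm n m k0 (k - k0)) +
        ∑ k0 ∈ Finset.range k, fnm n m k0 (k - k0 - 1) := by
  obtain ⟨N, rfl⟩ := Nat.exists_eq_add_of_le' hn
  obtain ⟨M, rfl⟩ := Nat.exists_eq_add_of_le' hm
  have hZ := finrank_Zk_add (F := F) (N := N) (M := M) k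
  have hD := finrank_map_diff_add (F := F) (N := N) (M := M) k
  rw [Hdim]
  cases k with
  | zero =>
    have hB : Bk F (pL (N + 1) (M + 1)) (ordL (N + 1) (M + 1)) (cL F (N + 1) (M + 1)) 0 ⊓
        Zk F (pL (N + 1) (M + 1)) (ordL (N + 1) (M + 1)) (cL F (N + 1) (M + 1)) 0 = ⊥ := by
      rw [eq_bot_iff]
      rintro v ⟨hv, hv', -⟩
      have hv1 := map_diff_AdmDeg_le 0 hv
      ext μ
      by_contra hμ
      have h1 := (hv1 μ hμ).2
      have h2 := (hv' μ hμ).2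
      omega
    rw [hB, finrank_bot]
    rw [card_admMonoms_zero] at hZ
    simp only [range_zero, sum_empty]
    omega
  | succ k =>
    have hB : Bk F (pL (N + 1) (M + 1)) (ordL (N + 1) (M + 1)) (cL F (N + 1) (M + 1)) (k + 1) ⊓
        Zk F (pL (N + 1) (M + 1)) (ordL (N + 1) (M + 1)) (cL F (N + 1) (M + 1)) (k + 1) =
        (AdmDeg F (pL (N + 1) (M + 1)) k).map (diff F N M) :=
      inf_eq_left.2 (le_inf (map_diff_AdmDeg_le k) (map_diff_AdmDeg_le_ker k))
    have hD' := finrank_map_diff_add (F := F) (N := N) (M := M) k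
    rw [hB]
    rw [card_admMonoms_succ] at hZ
    have hs : ∑ k0 ∈ range (k + 1), fnm (N + 1) (M + 1) k0 (k + 1 - k0 - 1) =
        ∑ a ∈ range (k + 1), fnm (N + 1) (M + 1) a (k - a) :=
      sum_congr rfl fun a _ => by rw [Nat.sub_right_comm, Nat.add_sub_cancel]
    rw [hs]
    omega

end Paper
end
end

section
/- The cohomology of the model filiform Lie superalgebra L_{1,2} with trivial coefficients over an algebraically closed field of characteristic zero has Betti numbers dim H^0 = 1, dim H^1 = 3, and dim H^k = 4 for all k ≥ 2; explicitly, H^k for k ≥ 2 has basis represented by the cocycles Y_1*^k, X_1* ∧ Y_1*^{k-1}, X_0* ∧ Y_2*^{k-1}, X_0* ∧ X_1* ∧ Y_2*^{k-2}. -/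
open scoped Classical
open Finset

noncomputable section
namespace Paper
open SuperCE

/-- representatives of the basis of `H^k(L_{1,2})` for `k ≥ 2`:
`Y_1*^k`, `X_1* ∧ Y_1*^{k-1}`, `X_0* ∧ Y_2*^{k-1}`, `X_0* ∧ X_1* ∧ Y_2*^{k-2}` -/
def L12basis (F : Type*) [Field F] (k : ℕ) : Fin 4 → Cochain F (Fin 2 ⊕ Fin 2) :=
  ![Finsupp.single (fun x => if x = Sum.inr (0 : Fin 2) then k else 0) 1,
    Finsupp.single (fun x => if x = Sum.inl (1 : Fin 2) then 1
      else if x = Sum.inr (0 : Fin 2) then k - 1 else 0) 1,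
    Finsupp.single (fun x => if x = Sum.inl (0 : Fin 2) then 1
      else if x = Sum.inr (1 : Fin 2) then k - 1 else 0) 1,
    Finsupp.single (fun x => if x = Sum.inl (0 : Fin 2) then 1
      else if x = Sum.inl (1 : Fin 2) then 1
      else if x = Sum.inr (1 : Fin 2) then k - 2 else 0) 1]

/-- The only nonzero differential of a dual generator of `L_{1,2}` is `d Y_2* = X_0* Y_1*`. -/
lemma dcoef_L12 (F : Type*) [Field F] (b k l : Fin 2 ⊕ Fin 2) :
    dcoef F (pL 1 2) (ordL 1 2) (cL F 1 2) b k l =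
      if b = Sum.inr 1 ∧ k = Sum.inl 0 ∧ l = Sum.inr 0 then 1 else 0 := by
  rcases b with b | b <;> rcases k with k | k <;> rcases l with l | l <;>
    fin_cases b <;> fin_cases k <;> fin_cases l <;> simp [dcoef, ordL, pL, cL]

/-- exponent vector of `X_0*^a X_1*^b Y_1*^m Y_2*^n` -/
def expL12 (a b m n : ℕ) : Fin 2 ⊕ Fin 2 → ℕ := Sum.elim ![a, b] ![m, n]

lemma eq_expL12_iff (μ : Fin 2 ⊕ Fin 2 → ℕ) (a b m n : ℕ) :
    μ = expL12 a b m n ↔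
      μ (Sum.inl 0) = a ∧ μ (Sum.inl 1) = b ∧ μ (Sum.inr 0) = m ∧ μ (Sum.inr 1) = n := by
  simp [funext_iff, expL12, Sum.forall, Fin.forall_fin_two, and_assoc]

lemma isAdm_L12_iff (μ : Fin 2 ⊕ Fin 2 → ℕ) :
    IsAdm (pL 1 2) μ ↔ μ (Sum.inl 0) ≤ 1 ∧ μ (Sum.inl 1) ≤ 1 := by
  simp [IsAdm, Sum.forall, pL, Fin.forall_fin_two]

lemma deg_L12 (μ : Fin 2 ⊕ Fin 2 → ℕ) :
    deg μ = μ (Sum.inl 0) + μ (Sum.inl 1) + (μ (Sum.inr 0) + μ (Sum.inr 1)) := by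
  simp [deg, Fintype.sum_sum_type, Fin.sum_univ_two]

lemma dMono_L12 (F : Type*) [Field F] (μ : Fin 2 ⊕ Fin 2 → ℕ) :
    dMono F (pL 1 2) (ordL 1 2) (cL F 1 2) μ =
      if μ (Sum.inr 1) ≠ 0 ∧ μ (Sum.inl 0) = 0 ∧ μ (Sum.inl 1) ≤ 1 then
        Finsupp.single (expL12 1 (μ (Sum.inl 1)) (μ (Sum.inr 0) + 1) (μ (Sum.inr 1) - 1))
          (μ (Sum.inr 1) : F)
      else 0 := by
  unfold dMono
  rw [Finset.sum_eq_single (Sum.inr 1), Finset.sum_eq_single (Sum.inl 0),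
    Finset.sum_eq_single (Sum.inr 0)]
  · have htgt : tgt μ (Sum.inr 1) (Sum.inl 0) (Sum.inr 0) =
        expL12 (μ (Sum.inl 0) + 1) (μ (Sum.inl 1)) (μ (Sum.inr 0) + 1) (μ (Sum.inr 1) - 1) := by
      simp [eq_expL12_iff, tgt, eps]
    rw [htgt]
    by_cases h : μ (Sum.inr 1) ≠ 0 ∧ μ (Sum.inl 0) = 0 ∧ μ (Sum.inl 1) ≤ 1
    · obtain ⟨h1, h2, h3⟩ := h
      rw [if_pos (by simp [isAdm_L12_iff, expL12, h1, h2, h3]), if_pos ⟨h1, h2, h3⟩, h2]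
      congr 1
      obtain ⟨n, hn⟩ := Nat.exists_eq_succ_of_ne_zero h1
      have he : (-1 : F) ^ (2 * (μ (Sum.inl 1) + μ (Sum.inr 0) + 2 * n)) = 1 := by
        rw [pow_mul, neg_one_sq, one_pow]
      rw [dcoef_L12]
      simp [sgnProd, Fintype.sum_sum_type, Fin.sum_univ_two, eps, pL, ordL, h2, hn]
      calc _ = ((n : F) + 1) * (-1) ^ (2 * (μ (Sum.inl 1) + μ (Sum.inr 0) + 2 * n)) := by
            ring
        _ = n + 1 := by rw [he, mul_one]
    · rw [if_neg h, if_neg]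
      simp only [isAdm_L12_iff, expL12]
      simpa using h
  all_goals simp +contextual [dcoef_L12]

lemma d_L12_apply (F : Type*) [Field F] (f : Cochain F (Fin 2 ⊕ Fin 2))
    (ν : Fin 2 ⊕ Fin 2 → ℕ) :
    d F (pL 1 2) (ordL 1 2) (cL F 1 2) f ν =
      if ν (Sum.inl 0) = 1 ∧ ν (Sum.inl 1) ≤ 1 ∧ ν (Sum.inr 0) ≠ 0 then
        ((ν (Sum.inr 1) + 1 : ℕ) : F) *
          f (expL12 0 (ν (Sum.inl 1)) (ν (Sum.inr 0) - 1) (ν (Sum.inr 1) + 1))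
      else 0 := by
  induction f using Finsupp.induction_linear with
  | zero => simp
  | add f g hf hg =>
    rw [map_add, Finsupp.add_apply, hf, hg]
    split_ifs <;> simp [mul_add]
  | single μ a =>
    have hd : d F (pL 1 2) (ordL 1 2) (cL F 1 2) (Finsupp.single μ a) =
        a • dMono F (pL 1 2) (ordL 1 2) (cL F 1 2) μ := by simp [d]
    rw [hd, dMono_L12, Finsupp.smul_apply]
    simp only [Finsupp.single_apply, eq_expL12_iff]
    by_cases h : μ (Sum.inr 1) ≠ 0 ∧ μ (Sum.inl 0) = 0 ∧ μ (Sum.inl 1) ≤ 1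
    · rw [if_pos h, Finsupp.single_apply]
      simp only [eq_comm (b := ν), eq_expL12_iff]
      have hn : μ (Sum.inr 1) = ν (Sum.inr 1) + 1 ↔ ν (Sum.inr 1) = μ (Sum.inr 1) - 1 := by
        omega
      split_ifs with h1 h2 h3 h4 h5
      · rw [h3.2.2.2, smul_eq_mul, mul_comm]
      all_goals first | omega | simp
    · rw [if_neg h]
      split_ifs with h1 h2
      · omega
      all_goals simp

/-- exponents of the monomial cocycles of degree `k` -/
def cocycleExps (k : ℕ) : Set (Fin 2 ⊕ Fin 2 → ℕ) :=
  {μ | (IsAdm (pL 1 2) μ ∧ deg μ = k) ∧ (μ (Sum.inl 0) = 1 ∨ μ (Sum.inr 1) = 0)}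

/-- exponents of the monomial coboundaries of degree `k` -/
def coboundaryExps (k : ℕ) : Set (Fin 2 ⊕ Fin 2 → ℕ) :=
  {μ | (IsAdm (pL 1 2) μ ∧ deg μ = k) ∧ (μ (Sum.inl 0) = 1 ∧ μ (Sum.inr 0) ≠ 0)}

lemma coboundaryExps_subset (k : ℕ) : coboundaryExps k ⊆ cocycleExps k :=
  fun _ h => ⟨h.1, Or.inl h.2.1⟩

lemma finite_cocycleExps (k : ℕ) : (cocycleExps k).Finite := by
  refine (Set.finite_Icc (0 : Fin 2 ⊕ Fin 2 → ℕ) (fun _ => k)).subset fun μ hμ => ?_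
  refine ⟨fun _ => Nat.zero_le _, fun b => ?_⟩
  rw [← hμ.1.2]
  exact Finset.single_le_sum (f := μ) (fun _ _ => Nat.zero_le _) (Finset.mem_univ b)

lemma mem_supported_iff_apply {F α : Type*} [Field F] (s : Set α) (f : α →₀ F) :
    f ∈ Finsupp.supported F F s ↔ ∀ μ, f μ ≠ 0 → μ ∈ s := by
  simp [Finsupp.mem_supported, Set.subset_def]

lemma Zk_L12 (F : Type*) [Field F] [CharZero F] (k : ℕ) :
    Zk F (pL 1 2) (ordL 1 2) (cL F 1 2) k = Finsupp.supported F F (cocycleExps k) := by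
  ext f
  rw [mem_supported_iff_apply, Zk, Submodule.mem_inf, LinearMap.mem_ker]
  constructor
  · rintro ⟨hf, h0⟩ μ hμ
    have hadm := hf μ hμ
    refine ⟨hadm, ?_⟩
    by_contra! hc
    have ha := (isAdm_L12_iff μ).1 hadm.1
    have := DFunLike.congr_fun h0
      (expL12 1 (μ (Sum.inl 1)) (μ (Sum.inr 0) + 1) (μ (Sum.inr 1) - 1))
    rw [d_L12_apply] at this
    have hpred : expL12 0 (μ (Sum.inl 1)) (μ (Sum.inr 0)) (μ (Sum.inr 1) - 1 + 1) = μ := by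
      rw [eq_comm, eq_expL12_iff]
      omega
    simp only [expL12, Sum.elim_inl, Sum.elim_inr, Matrix.cons_val_zero, Matrix.cons_val_one,
      Nat.add_sub_cancel] at this hpred
    rw [if_pos ⟨trivial, ha.2, Nat.succ_ne_zero _⟩, hpred] at this
    exact (mul_ne_zero (Nat.cast_ne_zero.2 (Nat.succ_ne_zero _)) hμ) this
  · intro hf
    refine ⟨fun μ hμ => (hf μ hμ).1, ?_⟩
    ext ν
    rw [d_L12_apply, Finsupp.zero_apply, ite_eq_right_iff]
    intro _
    rw [mul_eq_zero]
    right
    by_contra hc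
    simpa [expL12] using (hf _ hc).2

lemma Bk_L12 (F : Type*) [Field F] [CharZero F] (k : ℕ) :
    Bk F (pL 1 2) (ordL 1 2) (cL F 1 2) k = Finsupp.supported F F (coboundaryExps k) := by
  apply le_antisymm
  · rintro _ ⟨f, hf, rfl⟩
    rw [mem_supported_iff_apply]
    intro ν hν
    rw [d_L12_apply] at hν
    obtain ⟨h, hν⟩ := ite_ne_right_iff.1 hν
    have hd := (hf _ (right_ne_zero_of_mul hν)).2
    refine ⟨⟨(isAdm_L12_iff ν).2 ⟨h.1.le, h.2.1⟩, ?_⟩, h.1, h.2.2⟩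
    rw [deg_L12] at hd ⊢
    simp only [expL12, Sum.elim_inl, Sum.elim_inr, Matrix.cons_val_zero,
      Matrix.cons_val_one] at hd
    omega
  · rw [Finsupp.supported_eq_span_single, Submodule.span_le]
    rintro _ ⟨ν, hν, rfl⟩
    obtain ⟨⟨hadm, hdeg⟩, h1, h2⟩ := hν
    rw [isAdm_L12_iff] at hadm
    rw [deg_L12] at hdeg
    have hn : ((ν (Sum.inr 1) + 1 : ℕ) : F) ≠ 0 := Nat.cast_ne_zero.2 (Nat.succ_ne_zero _)
    refine ⟨Finsupp.single
      (expL12 0 (ν (Sum.inl 1)) (ν (Sum.inr 0) - 1) (ν (Sum.inr 1) + 1))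
      ((ν (Sum.inr 1) + 1 : ℕ) : F)⁻¹, ?_, ?_⟩
    · intro μ hμ
      rw [Finsupp.single_apply, ite_ne_right_iff] at hμ
      rw [← hμ.1, isAdm_L12_iff, deg_L12]
      simp only [expL12, Sum.elim_inl, Sum.elim_inr, Matrix.cons_val_zero, Matrix.cons_val_one]
      omega
    · simp only [d, Finsupp.lsum_single, LinearMap.toSpanSingleton_apply, dMono_L12]
      have hν : expL12 1 (ν (Sum.inl 1)) (ν (Sum.inr 0) - 1 + 1) (ν (Sum.inr 1)) = ν := by
        rw [eq_comm, eq_expL12_iff]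
        omega
      simp only [expL12, Sum.elim_inl, Sum.elim_inr, Matrix.cons_val_zero, Matrix.cons_val_one,
        Nat.add_sub_cancel] at hν ⊢
      rw [if_pos ⟨Nat.succ_ne_zero _, trivial, hadm.2⟩, hν, Finsupp.smul_single, smul_eq_mul,
        inv_mul_cancel₀ hn]

lemma finrank_supported (F : Type*) {α : Type*} [Field F] {s : Set α} (hs : s.Finite) :
    Module.finrank F (Finsupp.supported F F s) = s.ncard := by
  have := hs.fintype
  rw [(Finsupp.supportedEquivFinsupp s).finrank_eq, Module.finrank_finsupp_self,
    ← Nat.card_eq_fintype_card, Nat.card_coe_set_eq]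

lemma Hdim_L12 (F : Type*) [Field F] [CharZero F] (k : ℕ) :
    Hdim F (pL 1 2) (ordL 1 2) (cL F 1 2) k = (cocycleExps k \ coboundaryExps k).ncard := by
  rw [Hdim, Zk_L12, Bk_L12,
    inf_eq_left.2 (Finsupp.supported_mono (coboundaryExps_subset k)),
    finrank_supported F (finite_cocycleExps k),
    finrank_supported F ((finite_cocycleExps k).subset (coboundaryExps_subset k)),
    Set.ncard_sdiff (coboundaryExps_subset k)
      ((finite_cocycleExps k).subset (coboundaryExps_subset k))]

lemma mem_cocycleExps_diff_iff (k : ℕ) (μ : Fin 2 ⊕ Fin 2 → ℕ) :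
    μ ∈ cocycleExps k \ coboundaryExps k ↔
      μ (Sum.inl 0) ≤ 1 ∧ μ (Sum.inl 1) ≤ 1 ∧
      μ (Sum.inl 0) + μ (Sum.inl 1) + (μ (Sum.inr 0) + μ (Sum.inr 1)) = k ∧
      (μ (Sum.inl 0) = 0 ∧ μ (Sum.inr 1) = 0 ∨ μ (Sum.inl 0) = 1 ∧ μ (Sum.inr 0) = 0) := by
  simp only [cocycleExps, coboundaryExps, Set.mem_sdiff, Set.mem_ofPred_eq, isAdm_L12_iff, deg_L12]
  omega

/-- exponents of the representatives `L12basis` -/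
def basisExps (k : ℕ) : Fin 4 → (Fin 2 ⊕ Fin 2 → ℕ) :=
  ![expL12 0 0 k 0, expL12 0 1 (k - 1) 0, expL12 1 0 0 (k - 1), expL12 1 1 0 (k - 2)]

lemma L12basis_eq_single (F : Type*) [Field F] (k : ℕ) (i : Fin 4) :
    L12basis F k i = Finsupp.single (basisExps k i) 1 := by
  fin_cases i <;> simp only [L12basis, basisExps] <;> dsimp <;> congr 1 <;>
    simp [eq_expL12_iff]

lemma basisExps_injective (k : ℕ) : Function.Injective (basisExps k) := by
  intro i j h
  fin_cases i <;> fin_cases j <;> simp [basisExps, eq_expL12_iff] at h ⊢ <;>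
    simp [expL12] at h

lemma cocycleExps_diff_eq_range (k : ℕ) (hk : 2 ≤ k) :
    cocycleExps k \ coboundaryExps k = Set.range (basisExps k) := by
  ext μ
  rw [mem_cocycleExps_diff_iff]
  simp only [Set.mem_range, eq_comm (b := μ), basisExps, Fin.exists_fin_succ]
  simp [eq_expL12_iff]
  omega

lemma cocycleExps_diff_zero :
    cocycleExps 0 \ coboundaryExps 0 = {expL12 0 0 0 0} := by
  ext μ
  rw [mem_cocycleExps_diff_iff, Set.mem_singleton_iff, eq_expL12_iff]
  omega

lemma cocycleExps_diff_one :
    cocycleExps 1 \ coboundaryExps 1 = {expL12 0 0 1 0, expL12 0 1 0 0, expL12 1 0 0 0} := by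
  ext μ
  rw [mem_cocycleExps_diff_iff]
  simp only [Set.mem_insert_iff, Set.mem_singleton_iff, eq_expL12_iff]
  omega

lemma sum_L12basis_apply (F : Type*) [Field F] (k : ℕ) (a : Fin 4 → F)
    (j : Fin 4) : (∑ i, a i • L12basis F k i) (basisExps k j) = a j := by
  simp [L12basis_eq_single, Finsupp.single_apply, (basisExps_injective k).eq_iff]

/-- For the model filiform Lie superalgebra `L_{1,2}` over an
algebraically closed field of characteristic zero: `dim H^0 = 1`, `dim H^1 = 3`,
`dim H^k = 4` for `k ≥ 2`, and for `k ≥ 2` the classes of the cocycles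
`Y_1*^k`, `X_1* ∧ Y_1*^{k-1}`, `X_0* ∧ Y_2*^{k-1}`, `X_0* ∧ X_1* ∧ Y_2*^{k-2}`
form a basis of `H^k`. -/
theorem betti_L12
    (F : Type*) [Field F] [IsAlgClosed F] [CharZero F] :
    Hdim F (pL 1 2) (ordL 1 2) (cL F 1 2) 0 = 1 ∧
    Hdim F (pL 1 2) (ordL 1 2) (cL F 1 2) 1 = 3 ∧
    ∀ k : ℕ, 2 ≤ k →
      Hdim F (pL 1 2) (ordL 1 2) (cL F 1 2) k = 4 ∧
      (∀ i : Fin 4, L12basis F k i ∈ Zk F (pL 1 2) (ordL 1 2) (cL F 1 2) k) ∧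
      (∀ a : Fin 4 → F,
        (∑ i, a i • L12basis F k i) ∈ Bk F (pL 1 2) (ordL 1 2) (cL F 1 2) k →
        a = 0) ∧
      (∀ z ∈ Zk F (pL 1 2) (ordL 1 2) (cL F 1 2) k,
        ∃ a : Fin 4 → F,
          z - (∑ i, a i • L12basis F k i) ∈ Bk F (pL 1 2) (ordL 1 2) (cL F 1 2) k) := by
  refine ⟨?_, ?_, fun k hk => ⟨?_, fun i => ?_, fun a ha => ?_, fun z hz => ?_⟩⟩
  · rw [Hdim_L12, cocycleExps_diff_zero, Set.ncard_singleton]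
  · rw [Hdim_L12, cocycleExps_diff_one, Set.ncard_eq_three]
    refine ⟨_, _, _, ?_, ?_, ?_, rfl⟩ <;> simp [eq_expL12_iff] <;> simp [expL12]
  · rw [Hdim_L12, cocycleExps_diff_eq_range k hk, ← Nat.card_coe_set_eq,
      Nat.card_range_of_injective (basisExps_injective k), Nat.card_fin]
  · rw [Zk_L12, L12basis_eq_single]
    refine Finsupp.single_mem_supported F 1 ?_
    exact ((cocycleExps_diff_eq_range k hk).symm ▸ Set.mem_range_self i :
      basisExps k i ∈ cocycleExps k \ coboundaryExps k).1
  · rw [Bk_L12, mem_supported_iff_apply] at ha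
    ext j
    by_contra hj
    refine ((cocycleExps_diff_eq_range k hk).symm ▸ Set.mem_range_self j :
      basisExps k j ∈ cocycleExps k \ coboundaryExps k).2 (ha _ ?_)
    rwa [sum_L12basis_apply F k]
  · rw [Zk_L12, mem_supported_iff_apply] at hz
    refine ⟨fun i => z (basisExps k i), ?_⟩
    rw [Bk_L12, mem_supported_iff_apply]
    intro ν hν
    by_contra hc
    by_cases hr : ν ∈ Set.range (basisExps k)
    · obtain ⟨j, rfl⟩ := hr
      rw [Finsupp.sub_apply, sum_L12basis_apply F k, sub_self] at hν
      exact hν rfl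
    · have hz0 : z ν = 0 := by
        by_contra h
        exact hr (cocycleExps_diff_eq_range k hk ▸ ⟨hz ν h, hc⟩)
      refine hν ?_
      rw [Finsupp.sub_apply, hz0, Finsupp.finsetSum_apply, Finset.sum_eq_zero, sub_zero]
      intro i _
      rw [L12basis_eq_single, Finsupp.smul_apply,
        Finsupp.single_eq_of_ne (fun h => hr ⟨i, h.symm⟩), smul_zero]

end Paper
end
end

section
/- For the filiform Lie superalgebra F_{1,2}^2 over an algebraically closed field of characteristic zero, the Betti numbers of cohomology with trivial coefficients are dim H^0 = 1, dim H^1 = 3, and dim H^k = 4 for all k ≥ 2. -/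
open scoped Classical
open Finset

noncomputable section
namespace Paper
open SuperCE

/-- parity of the basis (evens then odds) -/
def pF122 : Fin 2 ⊕ Fin 2 → ℕ := Sum.elim (fun _ => 0) (fun _ => 1)

/-- ordering of the basis -/
def ordF122 : Fin 2 ⊕ Fin 2 → ℕ :=
  Sum.elim (fun i => (i : ℕ)) (fun j => 2 + (j : ℕ))

/-- structure constants -/
def cF122 (F : Type*) [Field F] :
    (Fin 2 ⊕ Fin 2) → (Fin 2 ⊕ Fin 2) → (Fin 2 ⊕ Fin 2) → F :=
  fun a b t =>
    if a = Sum.inl (0 : Fin 2) ∧ b = Sum.inr (0 : Fin 2) ∧ t = Sum.inr (1 : Fin 2) then 1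
    else if a = Sum.inr (0 : Fin 2) ∧ b = Sum.inl (0 : Fin 2) ∧ t = Sum.inr (1 : Fin 2) then -1
    else    if a = Sum.inl (1 : Fin 2) ∧ b = Sum.inr (0 : Fin 2) ∧ t = Sum.inr (1 : Fin 2) then 1
    else if a = Sum.inr (0 : Fin 2) ∧ b = Sum.inl (1 : Fin 2) ∧ t = Sum.inr (1 : Fin 2) then -1
    else 0

end Paper
end

noncomputable section
namespace Paper
open SuperCE

section BettiF122

/-- Exponent vector of the monomial `x₀ᵃ x₁ᵇ y₁ᵐ y₂ⁿ`. -/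
def mon (a b m n : ℕ) : Fin 2 ⊕ Fin 2 → ℕ := Sum.elim ![a, b] ![m, n]

lemma eq_mon (μ : Fin 2 ⊕ Fin 2 → ℕ) :
    μ = mon (μ (.inl 0)) (μ (.inl 1)) (μ (.inr 0)) (μ (.inr 1)) := by
  ext x
  rcases x with x | x <;> fin_cases x <;> rfl

lemma mon_inj {a b m n a' b' m' n' : ℕ} :
    mon a b m n = mon a' b' m' n' ↔ a = a' ∧ b = b' ∧ m = m' ∧ n = n' := by
  refine ⟨fun h => ?_, by rintro ⟨rfl, rfl, rfl, rfl⟩; rfl⟩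
  exact ⟨congrFun h (.inl 0), congrFun h (.inl 1), congrFun h (.inr 0), congrFun h (.inr 1)⟩

lemma isAdm_mon {a b m n : ℕ} : IsAdm pF122 (mon a b m n) ↔ a ≤ 1 ∧ b ≤ 1 := by
  simp [IsAdm, pF122, mon]

lemma deg_mon (a b m n : ℕ) : deg (mon a b m n) = a + b + m + n := by
  simp [deg, mon, add_assoc]

lemma tgt_mon_left (a b m n : ℕ) :
    tgt (mon a b m n) (.inr 1) (.inl 0) (.inr 0) = mon (a + 1) b (m + 1) (n - 1) := by
  ext x
  rcases x with x | x <;> fin_cases x <;> simp [tgt, eps, mon]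

lemma tgt_mon_right (a b m n : ℕ) :
    tgt (mon a b m n) (.inr 1) (.inl 1) (.inr 0) = mon a (b + 1) (m + 1) (n - 1) := by
  ext x
  rcases x with x | x <;> fin_cases x <;> simp [tgt, eps, mon]

variable (F : Type*) [Field F]

lemma dcoef_F122 (b k l : Fin 2 ⊕ Fin 2) :
    dcoef F pF122 ordF122 (cF122 F) b k l =
      if b = .inr 1 ∧ l = .inr 0 ∧ (k = .inl 0 ∨ k = .inl 1) then 1 else 0 := by
  rcases b with b | b <;> rcases k with k | k <;> rcases l with l | l <;>
    fin_cases b <;> fin_cases k <;> fin_cases l <;>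
    simp [dcoef, pF122, ordF122, cF122]

lemma d_single_s11 (μ : Fin 2 ⊕ Fin 2 → ℕ) :
    d F pF122 ordF122 (cF122 F) (Finsupp.single μ 1) = dMono F pF122 ordF122 (cF122 F) μ := by
  simp [d]

lemma dMono_mon (a b m n : ℕ) (ha : a ≤ 1) (hb : b ≤ 1) :
    dMono F pF122 ordF122 (cF122 F) (mon a b m n) =
      (if a = 0 then Finsupp.single (mon 1 b (m + 1) (n - 1)) (n : F) else 0) +
      (if b = 0 then Finsupp.single (mon a 1 (m + 1) (n - 1)) ((-1) ^ a * (n : F)) else 0) := by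
  simp only [dMono, dcoef_F122, Fintype.sum_sum_type, Fin.sum_univ_two]
  simp only [reduceCtorEq, and_false, if_false, mul_zero, zero_mul,
    Finsupp.single_zero, ite_self, add_zero, zero_add, Sum.inr.injEq, Sum.inl.injEq,
    zero_ne_one, one_ne_zero, and_true, or_false, false_or, if_true, or_self,
    mul_one, tgt_mon_left, tgt_mon_right, isAdm_mon]
  rcases n with _ | n
  · simp [mon]
  have hs (x : F) : (-1) ^ m * x * (-1) ^ n * ((-1) ^ m * (-1) ^ n) = x := by
    have h : (-1 : F) * -1 = 1 := by ring
    linear_combination x * ((-1 : F) ^ n * (-1) ^ n) * pow_mul_pow_eq_one m h +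
      x * pow_mul_pow_eq_one n h
  interval_cases a <;> interval_cases b <;>
    simp [-Finsupp.single_mul, -Finsupp.single_add, -Finsupp.single_neg, hs, sgnProd,
      Fintype.sum_sum_type, Fin.sum_univ_two, mon, pF122, ordF122, eps, pow_add]

lemma linearIndependent_of_dual_points {ι α : Type*} [Fintype ι] (w : ι → α →₀ F) (g : ι → α)
    (h : ∀ i j, w i (g j) = if i = j then 1 else 0) : LinearIndependent F w := by
  rw [Fintype.linearIndependent_iff]
  intro c hc j
  simpa [Finsupp.finsetSum_apply, h] using DFunLike.congr_fun hc (g j)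

/-- Exponent vectors of the admissible monomials of degree `k`. -/
def monIndex (k : ℕ) : Fin (k + 1) ⊕ Fin k ⊕ Fin k ⊕ Fin (k - 1) → (Fin 2 ⊕ Fin 2 → ℕ)
  | .inl i => mon 0 0 i (k - i)
  | .inr (.inl i) => mon 1 0 i (k - 1 - i)
  | .inr (.inr (.inl i)) => mon 0 1 i (k - 1 - i)
  | .inr (.inr (.inr i)) => mon 1 1 i (k - 2 - i)

lemma monIndex_injective (k : ℕ) : Function.Injective (monIndex k) := by
  rintro (i | i | i | i) (j | j | j | j) h <;> simp_all [monIndex, mon_inj, Fin.ext_iff]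

lemma mem_range_monIndex {k : ℕ} {μ : Fin 2 ⊕ Fin 2 → ℕ} :
    μ ∈ Set.range (monIndex k) ↔ IsAdm pF122 μ ∧ deg μ = k := by
  constructor
  · rintro ⟨i | i | i | i, rfl⟩ <;> have := i.isLt <;>
      simp only [monIndex, isAdm_mon, deg_mon] <;> omega
  · rintro ⟨hA, hD⟩
    obtain ⟨a, b, m, n, rfl⟩ : ∃ a b m n, μ = mon a b m n := ⟨_, _, _, _, eq_mon μ⟩
    rw [isAdm_mon] at hA
    rw [deg_mon] at hD
    obtain ⟨ha, hb⟩ := hA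
    interval_cases a <;> interval_cases b
    · exact ⟨.inl ⟨m, by omega⟩, by dsimp only [monIndex]; rw [mon_inj]; omega⟩
    · exact ⟨.inr (.inr (.inl ⟨m, by omega⟩)), by dsimp only [monIndex]; rw [mon_inj]; omega⟩
    · exact ⟨.inr (.inl ⟨m, by omega⟩), by dsimp only [monIndex]; rw [mon_inj]; omega⟩
    · exact ⟨.inr (.inr (.inr ⟨m, by omega⟩)), by dsimp only [monIndex]; rw [mon_inj]; omega⟩

lemma admDeg_eq_span (k : ℕ) :
    AdmDeg F pF122 k =
      Submodule.span F (Set.range fun i => (Finsupp.single (monIndex k i) (1 : F))) := by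
  apply le_antisymm
  · intro f hf
    rw [← f.sum_single]
    refine Submodule.sum_mem _ fun μ hμ => ?_
    obtain ⟨i, rfl⟩ := mem_range_monIndex.2 (hf μ (Finsupp.mem_support_iff.1 hμ))
    rw [← mul_one (f (monIndex k i)), ← smul_eq_mul, ← Finsupp.smul_single]
    exact Submodule.smul_mem _ _ (Submodule.subset_span ⟨i, rfl⟩)
  · rw [Submodule.span_le]
    rintro _ ⟨i, rfl⟩ μ hμ
    have : monIndex k i = μ := by
      by_contra h
      exact hμ (Finsupp.single_eq_of_ne' h)
    exact mem_range_monIndex.1 ⟨i, this⟩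

lemma single_mem_admDeg {a b m n k : ℕ} (ha : a ≤ 1) (hb : b ≤ 1)
    (h : a + b + m + n = k) (r : F) :
    Finsupp.single (mon a b m n) r ∈ AdmDeg F pF122 k := by
  intro μ hμ
  have : mon a b m n = μ := by
    by_contra h
    exact hμ (Finsupp.single_eq_of_ne' h)
  rw [← this, isAdm_mon, deg_mon]
  exact ⟨⟨ha, hb⟩, h⟩

lemma finrank_admDeg (k : ℕ) : Module.finrank F (AdmDeg F pF122 k) = 3 * k + 1 + (k - 1) := by
  rw [admDeg_eq_span, finrank_span_eq_card]
  · simp only [Fintype.card_sum, Fintype.card_fin]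
    omega
  · refine linearIndependent_of_dual_points F _ (monIndex k) fun i j => ?_
    simp [Finsupp.single_apply, (monIndex_injective k).eq_iff]

instance finiteDimensional_admDeg (k : ℕ) : FiniteDimensional F (AdmDeg F pF122 k) := by
  rw [admDeg_eq_span]
  exact FiniteDimensional.span_of_finite F (Set.finite_range _)

/-- A basis of the coboundaries of degree `k + 1`. -/
def cobound (k : ℕ) : Fin k ⊕ Fin (k - 1) → Cochain F (Fin 2 ⊕ Fin 2)
  | .inl i => Finsupp.single (mon 1 0 (i + 1) (k - 1 - i)) 1 +
      Finsupp.single (mon 0 1 (i + 1) (k - 1 - i)) 1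
  | .inr i => Finsupp.single (mon 1 1 (i + 1) (k - 2 - i)) 1

lemma linearIndependent_cobound (k : ℕ) : LinearIndependent F (cobound F k) := by
  refine linearIndependent_of_dual_points F _
    (Sum.elim (fun i => mon 1 0 (i + 1) (k - 1 - i)) fun i => mon 1 1 (i + 1) (k - 2 - i)) ?_
  rintro (i | i) (j | j) <;>
    simp only [cobound, Sum.elim_inl, Sum.elim_inr, Finsupp.add_apply, Finsupp.single_apply,
      mon_inj, Sum.inl.injEq, Sum.inr.injEq, Fin.ext_iff, reduceCtorEq] <;>
    grind

lemma map_d_admDeg [CharZero F] (k : ℕ) :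
    (AdmDeg F pF122 k).map (d F pF122 ordF122 (cF122 F)) =
      Submodule.span F (Set.range (cobound F k)) := by
  apply le_antisymm
  · rw [admDeg_eq_span, Submodule.map_span_le]
    have h1 (i : ℕ) (hi : i < k) (r : F) :
        r • (Finsupp.single (mon 1 0 (i + 1) (k - 1 - i)) 1 +
          Finsupp.single (mon 0 1 (i + 1) (k - 1 - i)) 1) ∈
        Submodule.span F (Set.range (cobound F k)) :=
      Submodule.smul_mem _ _ (Submodule.subset_span ⟨.inl ⟨i, hi⟩, rfl⟩)
    have h2 (i : ℕ) (hi : i < k - 1) (r : F) :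
        r • (Finsupp.single (mon 1 1 (i + 1) (k - 2 - i)) 1) ∈
        Submodule.span F (Set.range (cobound F k)) :=
      Submodule.smul_mem _ _ (Submodule.subset_span ⟨.inr ⟨i, hi⟩, rfl⟩)
    rintro _ ⟨i | i | i | i, rfl⟩ <;> have hi := i.isLt <;> simp only [monIndex] <;>
      rw [d_single_s11, dMono_mon _ _ _ _ _ (by omega) (by omega)]
    · rcases eq_or_ne (i : ℕ) k with h | h
      · simp [h]
      · have := h1 i (by omega) ((k - i : ℕ) : F)
        simpa [show k - i - 1 = k - 1 - i by omega] using this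
    · rcases eq_or_ne (i : ℕ) (k - 1) with h | h
      · simp [h]
      · have := h2 i (by omega) (-((k - 1 - i : ℕ) : F))
        simpa [show k - 1 - i - 1 = k - 2 - i by omega] using this
    · rcases eq_or_ne (i : ℕ) (k - 1) with h | h
      · simp [h]
      · have := h2 i (by omega) ((k - 1 - i : ℕ) : F)
        simpa [show k - 1 - i - 1 = k - 2 - i by omega] using this
    · simp
  · rw [Submodule.span_le]
    rintro _ ⟨i | i, rfl⟩ <;> have hi := i.isLt
    · have hn : ((k - i : ℕ) : F) ≠ 0 := Nat.cast_ne_zero.2 (by omega)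
      refine ⟨((k - i : ℕ) : F)⁻¹ • Finsupp.single (mon 0 0 i (k - i)) 1,
        Submodule.smul_mem _ _ (single_mem_admDeg F (by omega) (by omega) (by omega) _), ?_⟩
      rw [map_smul, d_single_s11, dMono_mon _ _ _ _ _ (by omega) (by omega)]
      generalize ((k - i : ℕ) : F) = r at hn ⊢
      simp [cobound, hn, show k - i - 1 = k - 1 - i by omega]
    · have hn : ((k - 1 - i : ℕ) : F) ≠ 0 := Nat.cast_ne_zero.2 (by omega)
      refine ⟨((k - 1 - i : ℕ) : F)⁻¹ • Finsupp.single (mon 0 1 i (k - 1 - i)) 1,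
        Submodule.smul_mem _ _ (single_mem_admDeg F (by omega) (by omega) (by omega) _), ?_⟩
      rw [map_smul, d_single_s11, dMono_mon _ _ _ _ _ (by omega) (by omega)]
      generalize ((k - 1 - i : ℕ) : F) = r at hn ⊢
      simp [cobound, hn, show k - 1 - i - 1 = k - 2 - i by omega]

lemma finrank_map_d_admDeg [CharZero F] (k : ℕ) :
    Module.finrank F ((AdmDeg F pF122 k).map (d F pF122 ordF122 (cF122 F))) = k + (k - 1) := by
  rw [map_d_admDeg, finrank_span_eq_card (linearIndependent_cobound F k)]
  simp

lemma finrank_Zk [CharZero F] (k : ℕ) :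
    Module.finrank F (Zk F pF122 ordF122 (cF122 F) k) = 2 * k + 1 := by
  have h := LinearMap.finrank_range_add_finrank_ker (K := F) (V := AdmDeg F pF122 k)
    (V₂ := Cochain F (Fin 2 ⊕ Fin 2))
    (f := (d F pF122 ordF122 (cF122 F)).domRestrict (AdmDeg F pF122 k))
  rw [LinearMap.range_domRestrict, finrank_map_d_admDeg, finrank_admDeg,
    LinearMap.ker_domRestrict, ← Submodule.finrank_map_subtype_eq,
    Submodule.map_comap_subtype] at h
  rw [Zk]
  omega

lemma map_d_admDeg_le_Zk [CharZero F] (k : ℕ) :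
    (AdmDeg F pF122 k).map (d F pF122 ordF122 (cF122 F)) ≤
      Zk F pF122 ordF122 (cF122 F) (k + 1) := by
  rw [map_d_admDeg, Submodule.span_le]
  rintro _ ⟨i | i, rfl⟩ <;> have hi := i.isLt <;> refine ⟨?_, LinearMap.mem_ker.2 ?_⟩
  · exact add_mem (single_mem_admDeg F (by omega) (by omega) (by omega) _)
      (single_mem_admDeg F (by omega) (by omega) (by omega) _)
  · simp [cobound, d_single_s11, dMono_mon]
  · exact single_mem_admDeg F (by omega) (by omega) (by omega) _
  · simp [cobound, d_single_s11, dMono_mon]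

lemma Hdim_succ [CharZero F] (k : ℕ) :
    Hdim F pF122 ordF122 (cF122 F) (k + 1) = 2 * (k + 1) + 1 - (k + (k - 1)) := by
  rw [Hdim, Bk, Nat.add_sub_cancel, inf_eq_left.2 (map_d_admDeg_le_Zk F k), finrank_Zk,
    finrank_map_d_admDeg]

lemma Hdim_zero [CharZero F] : Hdim F pF122 ordF122 (cF122 F) 0 = 1 := by
  have h : Bk F pF122 ordF122 (cF122 F) 0 = ⊥ := by
    rw [Bk, Nat.zero_sub, map_d_admDeg, Submodule.span_eq_bot]
    rintro _ ⟨i | i, rfl⟩ <;> exact i.elim0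
  rw [Hdim, h, bot_inf_eq, finrank_bot, finrank_Zk]

end BettiF122

/-- For the filiform Lie superalgebra `F_{1,2}²` (nonzero brackets `[X₀,Y₁] = [X₁,Y₁] = Y₂`) over an algebraically closed field of characteristic zero, the Betti numbers are `dim H^0 = 1`, `dim H^1 = 3` and `dim H^k = 4` for all `k ≥ 2`. -/
theorem betti_F122
    (F : Type*) [Field F] [IsAlgClosed F] [CharZero F] :
    Hdim F pF122 ordF122 (cF122 F) 0 = 1 ∧
    Hdim F pF122 ordF122 (cF122 F) 1 = 3 ∧
    (∀ k : ℕ, 2 ≤ k → Hdim F pF122 ordF122 (cF122 F) k = 4) := by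
  refine ⟨Hdim_zero F, Hdim_succ F 0, fun k hk => ?_⟩
  obtain ⟨k, rfl⟩ := Nat.exists_eq_add_of_le' hk
  rw [Hdim_succ F (k + 1)]
  omega

end Paper
end
end
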